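/- Let n ≥ 3. There exists ε₃ > 0 such that for every exponent p on the critical hyperbola with |p − (n+2)/(n−2)| ≤ ε₃ and q = q(p), the ground state (U_p, V_p) is non-degenerate: every pair (φ, ψ) of C² functions on ℝⁿ satisfying −Δφ = p V_p^{p−1} ψ and −Δψ = q U_p^{q−1} φ on ℝⁿ and (φ(x), ψ(x)) → (0,0) as |x| → ∞ is a linear combination of the n+1 pairs (∂U_p/∂x_j, ∂V_p/∂x_j) for j = 1, …, n and (x·∇U_p + (n−2 − n/(p+1)) U_p, x·∇V_p + (n−2 − n/(q+1)) V_p). -/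

import Mathlib

open Filter MeasureTheory Topology

noncomputable def lap {n : ℕ} (f : EuclideanSpace ℝ (Fin n) → ℝ)
    (x : EuclideanSpace ℝ (Fin n)) : ℝ :=
  ∑ i, fderiv ℝ (fderiv ℝ f) x (EuclideanSpace.single i 1) (EuclideanSpace.single i 1)

def IsGroundState (n : ℕ) (p q : ℝ) (U V : EuclideanSpace ℝ (Fin n) → ℝ) : Prop :=
  ContDiff ℝ 2 U ∧ ContDiff ℝ 2 V ∧
  (∀ x, 0 < U x) ∧ (∀ x, 0 < V x) ∧
  (∀ x, -lap U x = V x ^ p) ∧ (∀ x, -lap V x = U x ^ q) ∧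
  (∀ x y, ‖x‖ ≤ ‖y‖ → U y ≤ U x) ∧
  (∀ x y, ‖x‖ ≤ ‖y‖ → V y ≤ V x) ∧
  Tendsto U (cocompact _) (nhds 0) ∧
  Tendsto V (cocompact _) (nhds 0) ∧
  U 0 = 1

/-- Euclidean `n`-space. -/
abbrev Euc (n : ℕ) : Type := EuclideanSpace ℝ (Fin n)

/-- The `i`-th standard basis vector. -/
noncomputable abbrev stdVec {n : ℕ} (i : Fin n) : Euc n := EuclideanSpace.single i 1

/-- `k` is differentiable near `t₀` and its derivative has derivative `L` at `t₀`. -/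
def HasSecondDerivAt (k : ℝ → ℝ) (L t₀ : ℝ) : Prop :=
  ∃ k₁ : ℝ → ℝ, (∀ᶠ t in 𝓝 t₀, HasDerivAt k (k₁ t) t) ∧ HasDerivAt k₁ L t₀

namespace HasSecondDerivAt

variable {k m : ℝ → ℝ} {L M t₀ : ℝ}

lemma unique (h : HasSecondDerivAt k L t₀) (h' : HasSecondDerivAt k M t₀) : L = M := by
  obtain ⟨k₁, hk, hk₁⟩ := h
  obtain ⟨k₂, hk', hk₂⟩ := h'
  have : k₁ =ᶠ[𝓝 t₀] k₂ := by
    filter_upwards [hk, hk'] with t h1 h2 using h1.unique h2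
  exact hk₁.unique (hk₂.congr_of_eventuallyEq this)

lemma congr (h : HasSecondDerivAt k L t₀) (hkm : m =ᶠ[𝓝 t₀] k) : HasSecondDerivAt m L t₀ := by
  obtain ⟨k₁, hk, hk₁⟩ := h
  refine ⟨k₁, ?_, hk₁⟩
  filter_upwards [hk, hkm.eventuallyEq_nhds] with t h1 h2 using h1.congr_of_eventuallyEq h2

lemma add (h : HasSecondDerivAt k L t₀) (h' : HasSecondDerivAt m M t₀) :
    HasSecondDerivAt (fun t => k t + m t) (L + M) t₀ := by
  obtain ⟨k₁, hk, hk₁⟩ := h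
  obtain ⟨k₂, hk', hk₂⟩ := h'
  refine ⟨fun t => k₁ t + k₂ t, ?_, hk₁.add hk₂⟩
  filter_upwards [hk, hk'] with t h1 h2 using h1.add h2

lemma const_mul (c : ℝ) (h : HasSecondDerivAt k L t₀) :
    HasSecondDerivAt (fun t => c * k t) (c * L) t₀ := by
  obtain ⟨k₁, hk, hk₁⟩ := h
  refine ⟨fun t => c * k₁ t, ?_, hk₁.const_mul c⟩
  filter_upwards [hk] with t h1 using h1.const_mul c

lemma sub (h : HasSecondDerivAt k L t₀) (h' : HasSecondDerivAt m M t₀) :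
    HasSecondDerivAt (fun t => k t - m t) (L - M) t₀ := by
  have := h.add (h'.const_mul (-1))
  simpa [sub_eq_add_neg] using this

lemma comp_neg (h : HasSecondDerivAt k L 0) : HasSecondDerivAt (fun t => k (-t)) L 0 := by
  obtain ⟨k₁, hk, hk₁⟩ := h
  refine ⟨fun t => -k₁ (-t), ?_, ?_⟩
  · have : Tendsto (fun t : ℝ => -t) (𝓝 0) (𝓝 0) := by
      simpa using (continuous_neg (G := ℝ)).tendsto 0
    filter_upwards [this.eventually hk] with t ht
    have := ht.comp t (hasDerivAt_neg t)
    simpa [Function.comp_def] using this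
  · have h0 : HasDerivAt k₁ L (-0) := by simpa using hk₁
    exact (h0.comp (0 : ℝ) (hasDerivAt_neg 0)).fun_neg.congr_deriv (by simp)

/-- Second derivative test at a local maximum. -/
lemma nonpos_of_isLocalMax (h : HasSecondDerivAt k L t₀) (hmax : IsLocalMax k t₀) : L ≤ 0 := by
  by_contra! hL
  obtain ⟨k₁, hk, hk₁⟩ := h
  have hd : deriv k =ᶠ[𝓝 t₀] k₁ := by
    filter_upwards [hk] with t ht using ht.deriv
  have hdd : deriv (deriv k) t₀ = L := by rw [hd.deriv_eq]; exact hk₁.deriv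
  have hmin : IsLocalMin k t₀ := isLocalMin_of_deriv_deriv_pos (by rw [hdd]; exact hL)
    hmax.deriv_eq_zero hk.self_of_nhds.continuousAt
  have hc : k =ᶠ[𝓝 t₀] fun _ => k t₀ := by
    filter_upwards [hmax, hmin] with t h1 h2 using le_antisymm h1 h2
  have h0 : HasSecondDerivAt k 0 t₀ :=
    HasSecondDerivAt.congr ⟨fun _ => 0, .of_forall fun t => hasDerivAt_const t _,
      hasDerivAt_const _ _⟩ hc
  exact hL.ne' (unique ⟨k₁, hk, hk₁⟩ h0)

end HasSecondDerivAt

section Laplacian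

variable {n : ℕ} {f g : Euc n → ℝ}

lemma hasSecondDerivAt_line (hf : ContDiff ℝ 2 f) (x e : Euc n) :
    HasSecondDerivAt (fun t : ℝ => f (x + t • e)) (fderiv ℝ (fderiv ℝ f) x e e) 0 := by
  have hl : ∀ t : ℝ, HasDerivAt (fun t : ℝ => x + t • e) e t := fun t => by
    simpa using ((hasDerivAt_id t).smul_const e).const_add x
  refine ⟨fun t => fderiv ℝ f (x + t • e) e, .of_forall fun t => ?_, ?_⟩
  · exact ((hf.differentiable (by norm_num)) _).hasFDerivAt.comp_hasDerivAt t (hl t)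
  · have hf' : ContDiff ℝ 1 (fderiv ℝ f) := hf.fderiv_right (by norm_num)
    have h1 : HasFDerivAt (fderiv ℝ f) (fderiv ℝ (fderiv ℝ f) x) (x + (0 : ℝ) • e) := by
      simpa using ((hf'.differentiable (by norm_num)) x).hasFDerivAt
    have h2 := h1.comp_hasDerivAt 0 (hl 0)
    have h3 := ((ContinuousLinearMap.apply ℝ ℝ e).hasFDerivAt).comp_hasDerivAt 0 h2
    simpa [Function.comp_def] using h3

lemma lap_eq_sum_of_hasSecondDerivAt (hf : ContDiff ℝ 2 f) {x : Euc n} {L : Fin n → ℝ}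
    (h : ∀ i, HasSecondDerivAt (fun t : ℝ => f (x + t • stdVec i)) (L i) 0) :
    lap f x = ∑ i, L i :=
  Finset.sum_congr rfl fun i _ => (hasSecondDerivAt_line hf x _).unique (h i)

lemma lap_add (hf : ContDiff ℝ 2 f) (hg : ContDiff ℝ 2 g) (x : Euc n) :
    lap (fun y => f y + g y) x = lap f x + lap g x := by
  rw [lap_eq_sum_of_hasSecondDerivAt (hf.add hg) fun i =>
    (hasSecondDerivAt_line hf x _).add (hasSecondDerivAt_line hg x _)]
  exact Finset.sum_add_distrib

lemma lap_const_mul (c : ℝ) (hf : ContDiff ℝ 2 f) (x : Euc n) :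
    lap (fun y => c * f y) x = c * lap f x := by
  rw [lap_eq_sum_of_hasSecondDerivAt (contDiff_const.mul hf) fun i =>
    (hasSecondDerivAt_line hf x _).const_mul c]
  exact (Finset.mul_sum _ _ _).symm

open InnerProductSpace in
lemma lap_eq_laplacian (f : Euc n → ℝ) (x : Euc n) : lap f x = Laplacian.laplacian f x := by
  rw [laplacian_eq_iteratedFDeriv_orthonormalBasis f (EuclideanSpace.basisFun (Fin n) ℝ)]
  simp [lap, iteratedFDeriv_two_apply]

lemma lap_comp_isometry (T : Euc n ≃ₗᵢ[ℝ] Euc n) (hf : ContDiff ℝ 2 f) (x : Euc n) :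
    lap (fun y => f (T y)) x = lap f (T x) := by
  have hfT : ContDiff ℝ 2 fun y => f (T y) := hf.comp T.contDiff
  have h1 : ∀ i : Fin n, HasSecondDerivAt (fun t : ℝ => f (T (x + t • stdVec i)))
      (fderiv ℝ (fderiv ℝ f) (T x) (T (stdVec i)) (T (stdVec i))) 0 := fun i => by
    simpa using hasSecondDerivAt_line hf (T x) (T (stdVec i))
  rw [lap_eq_sum_of_hasSecondDerivAt hfT h1, lap_eq_laplacian,
    InnerProductSpace.laplacian_eq_iteratedFDeriv_orthonormalBasis f
      ((EuclideanSpace.basisFun (Fin n) ℝ).map T)]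
  simp [iteratedFDeriv_two_apply]

lemma norm_add_smul_stdVec_sq (x : Euc n) (i : Fin n) (t : ℝ) :
    ‖x + t • stdVec i‖ ^ 2 = ‖x‖ ^ 2 + 2 * t * x i + t ^ 2 := by
  rw [norm_add_sq_real, inner_smul_right, EuclideanSpace.inner_single_right, norm_smul]
  simp
  ring

lemma hasDerivAt_norm_line {x : Euc n} {i : Fin n} {t : ℝ} (h : x + t • stdVec i ≠ 0) :
    HasDerivAt (fun t : ℝ => ‖x + t • stdVec i‖) ((x i + t) / ‖x + t • stdVec i‖) t := by
  have h0 : ‖x + t • stdVec i‖ ≠ 0 := norm_ne_zero_iff.2 h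
  have heq : (fun t : ℝ => ‖x + t • stdVec i‖) =
      fun t => √(‖x‖ ^ 2 + 2 * t * x i + t ^ 2) := by
    funext s
    rw [← norm_add_smul_stdVec_sq, Real.sqrt_sq (norm_nonneg _)]
  have h1 : HasDerivAt (fun t : ℝ => ‖x‖ ^ 2 + 2 * t * x i + t ^ 2) (2 * x i + 2 * t) t := by
    have := (((hasDerivAt_id t).const_mul 2).mul_const (x i)).const_add (‖x‖ ^ 2)
    exact (this.fun_add (hasDerivAt_pow 2 t)).congr_deriv (by simp)
  have h2 := h1.sqrt (by rw [← norm_add_smul_stdVec_sq]; positivity)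
  rw [← norm_add_smul_stdVec_sq, Real.sqrt_sq (norm_nonneg _)] at h2
  rw [heq]
  convert h2 using 1
  field_simp

lemma eventually_line_ne_zero {x : Euc n} (hx : x ≠ 0) (e : Euc n) :
    ∀ᶠ t : ℝ in 𝓝 0, x + t • e ≠ 0 := by
  have : Continuous fun t : ℝ => x + t • e := by fun_prop
  exact this.continuousAt.eventually_ne (by simpa using hx)

lemma hasDerivAt_radial_line {G G₁ : ℝ → ℝ} (h : ∀ r, 0 < r → HasDerivAt G (r * G₁ r) r)
    {x : Euc n} {i : Fin n} {t : ℝ} (hx : x + t • stdVec i ≠ 0) :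
    HasDerivAt (fun t : ℝ => G ‖x + t • stdVec i‖) ((x i + t) * G₁ ‖x + t • stdVec i‖) t := by
  have h0 : 0 < ‖x + t • stdVec i‖ := norm_pos_iff.2 hx
  exact ((h _ h0).comp t (hasDerivAt_norm_line hx)).congr_deriv (by field_simp)

/-- Second derivative of a radial function along a coordinate line; `G₁` and `G₂` are obtained
from `G` by iterating `r⁻¹ d/dr`. -/
lemma hasSecondDerivAt_radial_line {G G₁ G₂ : ℝ → ℝ}
    (h : ∀ r, 0 < r → HasDerivAt G (r * G₁ r) r)
    (h₁ : ∀ r, 0 < r → HasDerivAt G₁ (r * G₂ r) r) {x : Euc n} (hx : x ≠ 0) (i : Fin n) :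
    HasSecondDerivAt (fun t : ℝ => G ‖x + t • stdVec i‖) (G₁ ‖x‖ + x i ^ 2 * G₂ ‖x‖) 0 := by
  refine ⟨fun t => (x i + t) * G₁ ‖x + t • stdVec i‖, ?_, ?_⟩
  · filter_upwards [eventually_line_ne_zero hx (stdVec i)] with t ht
    exact hasDerivAt_radial_line h ht
  · have h2 := ((hasDerivAt_id (0 : ℝ)).const_add (x i)).fun_mul
      (hasDerivAt_radial_line h₁ (x := x) (i := i) (t := 0) (by simpa using hx))
    refine h2.congr_deriv ?_
    simp only [id, zero_smul, add_zero, one_mul]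
    ring

end Laplacian

section Comparison

variable {n : ℕ} {Ω : Set (Euc n)} {Φ Ψ P Q c₁ c₂ : Euc n → ℝ}

/-- `c Q < -ΔP` at `x`, with second derivatives taken along coordinate lines. -/
def IsStrictSuperAt (P Q c : Euc n → ℝ) (x : Euc n) : Prop :=
  ∃ L : Fin n → ℝ, (∀ i, HasSecondDerivAt (fun t : ℝ => P (x + t • stdVec i)) (L i) 0) ∧
    c x * Q x < -∑ i, L i

lemma IsStrictSuperAt.false_of_touching (hΩ : IsOpen Ω) (hΦ : ContDiff ℝ 2 Φ) {x : Euc n}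
    (hx : x ∈ Ω) (hP : IsStrictSuperAt P Q c₁ x) (heq : -lap Φ x = c₁ x * Ψ x) (hc : 0 ≤ c₁ x)
    {T : ℝ} (hT : 0 < T) (htouch : Φ x = T * P x) (hle : ∀ y ∈ Ω, Φ y ≤ T * P y)
    (hΨ : Ψ x ≤ T * Q x) : False := by
  obtain ⟨L, hL, hlt⟩ := hP
  have hi : ∀ i : Fin n,
      fderiv ℝ (fderiv ℝ Φ) x (stdVec i) (stdVec i) - T * L i ≤ 0 := fun i => by
    refine ((hasSecondDerivAt_line hΦ x (stdVec i)).sub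
      ((hL i).const_mul T)).nonpos_of_isLocalMax ?_
    have hcont : Continuous fun t : ℝ => x + t • (stdVec i : Euc n) := by fun_prop
    have hmem : ∀ᶠ t : ℝ in 𝓝 0, x + t • (stdVec i : Euc n) ∈ Ω :=
      hcont.continuousAt.eventually_mem (hΩ.mem_nhds (by simpa using hx))
    filter_upwards [hmem] with t ht
    have := hle _ ht
    simp only [zero_smul, add_zero]
    linarith
  have hsum : lap Φ x - T * ∑ i, L i ≤ 0 := by
    rw [Finset.mul_sum, lap, ← Finset.sum_sub_distrib]
    exact Finset.sum_nonpos fun i _ => hi i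
  have h1 : c₁ x * Ψ x ≤ c₁ x * (T * Q x) := mul_le_mul_of_nonneg_left hΨ hc
  have h2 : T * (c₁ x * Q x) < T * -∑ i, L i := mul_lt_mul_of_pos_left hlt hT
  linarith

/-- Comparison principle for a cooperative linear system with a strict positive supersolution. -/
lemma nonpos_of_strict_super (hΩ : IsOpen Ω) (hΦ : ContDiff ℝ 2 Φ) (hΨ : ContDiff ℝ 2 Ψ)
    (h₁ : ∀ x, -lap Φ x = c₁ x * Ψ x) (h₂ : ∀ x, -lap Ψ x = c₂ x * Φ x)
    (hc₁ : ∀ x, 0 ≤ c₁ x) (hc₂ : ∀ x, 0 ≤ c₂ x)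
    (hbΦ : ∀ x ∈ closure Ω, x ∉ Ω → Φ x = 0) (hbΨ : ∀ x ∈ closure Ω, x ∉ Ω → Ψ x = 0)
    (hdΦ : Tendsto Φ (cocompact _) (𝓝 0)) (hdΨ : Tendsto Ψ (cocompact _) (𝓝 0))
    {η : ℝ} (hη : 0 < η) (hPη : ∀ x ∈ Ω, η ≤ P x) (hQη : ∀ x ∈ Ω, η ≤ Q x)
    (hPc : ContinuousOn P Ω) (hQc : ContinuousOn Q Ω)
    (hP : ∀ x ∈ Ω, IsStrictSuperAt P Q c₁ x) (hQ : ∀ x ∈ Ω, IsStrictSuperAt Q P c₂ x) :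
    ∀ x ∈ Ω, Φ x ≤ 0 ∧ Ψ x ≤ 0 := by
  by_contra! hcon
  obtain ⟨x₀, hx₀, hpos⟩ := hcon
  have hP0 : ∀ x ∈ Ω, 0 < P x := fun x hx => hη.trans_le (hPη x hx)
  have hQ0 : ∀ x ∈ Ω, 0 < Q x := fun x hx => hη.trans_le (hQη x hx)
  set M : Euc n → ℝ := fun x => max (Φ x / P x) (Ψ x / Q x) with hM
  have hm : 0 < M x₀ := by
    by_cases h : Φ x₀ ≤ 0
    · exact lt_max_of_lt_right (div_pos (hpos h) (hQ0 _ hx₀))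
    · exact lt_max_of_lt_left (div_pos (not_le.1 h) (hP0 _ hx₀))
  set m := M x₀
  have hmη : 0 < m * η := mul_pos hm hη
  set K : Set (Euc n) := closure Ω ∩ ({x | m * η ≤ Φ x} ∪ {x | m * η ≤ Ψ x}) with hK
  have hbd : ∀ {f : Euc n → ℝ}, Tendsto f (cocompact _) (𝓝 0) → Continuous f →
      IsCompact {x | m * η ≤ f x} := fun {f} hf hfc => by
    have h1 : ∀ᶠ x in cocompact (Euc n), f x < m * η := hf.eventually_lt_const hmη
    obtain ⟨t, ht, hts⟩ := mem_cocompact.1 h1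
    refine ht.of_isClosed_subset (isClosed_le continuous_const hfc) fun x (hx : m * η ≤ f x) => ?_
    by_contra hxt
    exact absurd hx (not_le.2 (hts hxt))
  have hKc : IsCompact K :=
    ((hbd hdΦ hΦ.continuous).union (hbd hdΨ hΨ.continuous)).inter_left isClosed_closure
  have hKΩ : K ⊆ Ω := fun x hx => by
    by_contra hxΩ
    rcases hx.2 with h | h
    · have : m * η ≤ Φ x := h
      rw [hbΦ x hx.1 hxΩ] at this
      linarith
    · have : m * η ≤ Ψ x := h
      rw [hbΨ x hx.1 hxΩ] at this
      linarith
  have hout : ∀ x ∈ Ω, m ≤ M x → x ∈ K := fun x hx hmx => by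
    refine ⟨subset_closure hx, ?_⟩
    rcases le_max_iff.1 hmx with h | h
    · exact Or.inl (((mul_le_mul_of_nonneg_left (hPη x hx) hm.le)).trans
        ((le_div_iff₀ (hP0 x hx)).1 h))
    · exact Or.inr (((mul_le_mul_of_nonneg_left (hQη x hx) hm.le)).trans
        ((le_div_iff₀ (hQ0 x hx)).1 h))
  have hMc : ContinuousOn M K := by
    refine ContinuousOn.sup ?_ ?_
    · exact hΦ.continuous.continuousOn.div (hPc.mono hKΩ) fun x hx => (hP0 x (hKΩ hx)).ne'
    · exact hΨ.continuous.continuousOn.div (hQc.mono hKΩ) fun x hx => (hQ0 x (hKΩ hx)).ne'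
  obtain ⟨x, hxK, hxmax⟩ := hKc.exists_isMaxOn ⟨x₀, hout x₀ hx₀ le_rfl⟩ hMc
  have hxΩ := hKΩ hxK
  have hmM : m ≤ M x := hxmax (hout x₀ hx₀ le_rfl)
  have hall : ∀ y ∈ Ω, M y ≤ M x := fun y hy => by
    by_cases h : m ≤ M y
    · exact hxmax (hout y hy h)
    · exact (not_le.1 h).le.trans hmM
  have hT : 0 < M x := hm.trans_le hmM
  have hΦle : ∀ y ∈ Ω, Φ y ≤ M x * P y := fun y hy =>
    (div_le_iff₀ (hP0 y hy)).1 ((le_max_left _ _).trans (hall y hy))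
  have hΨle : ∀ y ∈ Ω, Ψ y ≤ M x * Q y := fun y hy =>
    (div_le_iff₀ (hQ0 y hy)).1 ((le_max_right _ _).trans (hall y hy))
  rcases max_choice (Φ x / P x) (Ψ x / Q x) with h | h
  · refine (hP x hxΩ).false_of_touching hΩ hΦ hxΩ (h₁ x) (hc₁ x) hT ?_ hΦle (hΨle x hxΩ)
    change Φ x = max _ _ * _
    rw [h, div_mul_cancel₀ _ (hP0 x hxΩ).ne']
  · refine (hQ x hxΩ).false_of_touching hΩ hΨ hxΩ (h₂ x) (hc₂ x) hT ?_ hΨle (hΦle x hxΩ)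
    change Ψ x = max _ _ * _
    rw [h, div_mul_cancel₀ _ (hQ0 x hxΩ).ne']

end Comparison

section RadialProfile

variable {n : ℕ} {F : Euc n → ℝ}

/-- The function `-F'(r) / r` attached to the restriction of `F` to the ray through `e`. -/
noncomputable def raySlope (F : Euc n → ℝ) (e : Euc n) (r : ℝ) : ℝ :=
  -deriv (fun t : ℝ => F (t • e)) r / r

lemma contDiff_ray (hF : ContDiff ℝ 2 F) (e : Euc n) : ContDiff ℝ 2 fun t : ℝ => F (t • e) :=
  hF.comp (by fun_prop)

lemma hasDerivAt_ray (hF : ContDiff ℝ 2 F) (e : Euc n) {r : ℝ} (hr : 0 < r) :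
    HasDerivAt (fun t : ℝ => F (t • e)) (r * -raySlope F e r) r := by
  have h := (((contDiff_ray hF e).differentiable (by norm_num)) r).hasDerivAt
  refine h.congr_deriv ?_
  rw [raySlope]
  field_simp

lemma hasDerivAt_deriv_ray (hF : ContDiff ℝ 2 F) (e : Euc n) (r : ℝ) :
    HasDerivAt (deriv fun t : ℝ => F (t • e)) (deriv (deriv fun t : ℝ => F (t • e)) r) r := by
  have h : ContDiff ℝ 1 (deriv fun t : ℝ => F (t • e)) :=
    (contDiff_succ_iff_deriv.1 (by rw [one_add_one_eq_two]; exact contDiff_ray hF e)).2.2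
  exact ((h.differentiable (by norm_num)) r).hasDerivAt

lemma norm_smul_stdVec (i : Fin n) (r : ℝ) : ‖r • (stdVec i : Euc n)‖ = |r| := by
  rw [norm_smul]; simp

lemma hasDerivAt_raySlope_aux (hF : ContDiff ℝ 2 F) (e : Euc n) {r : ℝ} (hr : 0 < r) :
    HasDerivAt (raySlope F e)
      (r * ((-deriv (deriv fun t : ℝ => F (t • e)) r - raySlope F e r) / r ^ 2)) r := by
  have h := (hasDerivAt_deriv_ray hF e r).fun_neg.fun_div (hasDerivAt_id r) hr.ne'
  refine h.congr_deriv ?_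
  simp only [raySlope, id]
  field_simp

lemma hasDerivAt_raySlope (hrad : ∀ x y, ‖x‖ = ‖y‖ → F x = F y) {f : ℝ → ℝ}
    (hf : ∀ x, -lap F x = f ‖x‖) (hF : ContDiff ℝ 2 F) (i : Fin n) {r : ℝ} (hr : 0 < r) :
    HasDerivAt (raySlope F (stdVec i)) (r * ((f r - n * raySlope F (stdVec i) r) / r ^ 2)) r := by
  set G₂ : ℝ → ℝ := fun r =>
    -((-deriv (deriv fun t : ℝ => F (t • stdVec i)) r - raySlope F (stdVec i) r) / r ^ 2) with hG₂
  have hx : r • (stdVec i : Euc n) ≠ 0 := by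
    rw [← norm_ne_zero_iff, norm_smul_stdVec]
    exact (abs_pos.2 hr.ne').ne'
  have hnorm : ‖r • (stdVec i : Euc n)‖ = r := by rw [norm_smul_stdVec, abs_of_pos hr]
  have hline : ∀ j : Fin n, HasSecondDerivAt (fun t : ℝ => F (r • stdVec i + t • stdVec j))
      (-raySlope F (stdVec i) r + (r • (stdVec i : Euc n)) j ^ 2 * G₂ r) 0 := fun j => by
    have := hasSecondDerivAt_radial_line (G := fun t : ℝ => F (t • stdVec i))
      (G₁ := fun r => -raySlope F (stdVec i) r) (G₂ := G₂)
      (fun r hr => hasDerivAt_ray hF _ hr)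
      (fun r hr => (hasDerivAt_raySlope_aux hF _ hr).fun_neg.congr_deriv (by rw [hG₂]; ring)) hx j
    rw [hnorm] at this
    refine this.congr (.of_forall fun t => hrad _ _ ?_)
    rw [norm_smul_stdVec, abs_norm]
  have hlap := lap_eq_sum_of_hasSecondDerivAt hF hline
  rw [Finset.sum_add_distrib, ← Finset.sum_mul, ← EuclideanSpace.real_norm_sq_eq, hnorm] at hlap
  have h2 := hf (r • stdVec i)
  rw [hnorm, hlap] at h2
  simp only [Finset.sum_const, Finset.card_univ, Fintype.card_fin, nsmul_eq_mul] at h2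
  refine (hasDerivAt_raySlope_aux hF _ hr).congr_deriv ?_
  have h3 : r ^ 2 * G₂ r = -(-deriv (deriv fun t : ℝ => F (t • stdVec i)) r
      - raySlope F (stdVec i) r) := by rw [hG₂]; field_simp
  rw [← h2, h3]
  congr 2
  ring

lemma tendsto_raySlope (hrad : ∀ x y, ‖x‖ = ‖y‖ → F x = F y) {f : ℝ → ℝ}
    (hf : ∀ x, -lap F x = f ‖x‖) (hF : ContDiff ℝ 2 F) (i : Fin n) :
    Tendsto (raySlope F (stdVec i)) (𝓝[>] 0) (𝓝 (f 0 / n)) := by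
  set g : ℝ → ℝ := fun t => F (t • stdVec i) with hg
  have hd := hasDerivAt_deriv_ray hF (stdVec i) 0
  have heven : ∀ t, g (-t) = g t := fun t => hrad _ _ (by simp)
  have h0 : deriv g 0 = 0 := by
    have := deriv_comp_neg g 0
    rw [show (fun x => g (-x)) = g from funext heven, neg_zero] at this
    linarith
  have hlap : lap F 0 = n * deriv (deriv g) 0 := by
    rw [lap_eq_sum_of_hasSecondDerivAt hF (x := 0) (L := fun _ => deriv (deriv g) 0)]
    · simp
    · intro j
      refine HasSecondDerivAt.congr (k := g) ⟨deriv g, .of_forall fun t => ?_, hd⟩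
        (.of_forall fun t => hrad _ _ ?_)
      · exact (((contDiff_ray hF _).differentiable (by norm_num)) t).hasDerivAt
      · rw [zero_add, norm_smul_stdVec, norm_smul_stdVec]
  have hn : (n : ℝ) ≠ 0 := by
    have := i.pos
    positivity
  have hval : f 0 / n = -deriv (deriv g) 0 := by
    have := hf 0
    rw [norm_zero, hlap] at this
    rw [← this]
    field_simp
  have ht := (hasDerivAt_iff_tendsto_slope.1 hd).mono_left
    (nhdsWithin_mono 0 (fun x (hx : 0 < x) => hx.ne') : 𝓝[>] (0 : ℝ) ≤ 𝓝[≠] 0)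
  rw [hval]
  refine ht.neg.congr fun r => ?_
  change -(slope _ _ _) = -deriv g r / r
  rw [slope_def_field, h0]
  ring

end RadialProfile

section Monotonicity

variable {h h' : ℝ → ℝ}

lemma le_of_hasDerivAt_nonneg (hd : ∀ r, 0 < r → HasDerivAt h (h' r) r) {a b : ℝ} (ha : 0 < a)
    (hab : a ≤ b) (hn : ∀ r, a < r → r < b → 0 ≤ h' r) : h a ≤ h b := by
  have hm : MonotoneOn h (Set.Icc a b) := by
    refine monotoneOn_of_hasDerivWithinAt_nonneg (f' := h') (convex_Icc a b)
      (fun r hr => (hd r (ha.trans_le hr.1)).continuousAt.continuousWithinAt)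
      (fun r hr => ?_) (fun r hr => ?_)
    · rw [interior_Icc] at hr
      exact (hd r (ha.trans hr.1)).hasDerivWithinAt
    · rw [interior_Icc] at hr
      exact hn r hr.1 hr.2
  exact hm (Set.left_mem_Icc.2 hab) (Set.right_mem_Icc.2 hab) hab

lemma ge_of_hasDerivAt_nonpos (hd : ∀ r, 0 < r → HasDerivAt h (h' r) r) {a b : ℝ} (ha : 0 < a)
    (hab : a ≤ b) (hn : ∀ r, a < r → r < b → h' r ≤ 0) : h b ≤ h a := by
  have := le_of_hasDerivAt_nonneg (h := fun r => -h r) (h' := fun r => -h' r)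
    (fun r hr => (hd r hr).fun_neg) ha hab (fun r h1 h2 => by have := hn r h1 h2; linarith)
  linarith

lemma limit_le_of_hasDerivAt_nonneg (hd : ∀ r, 0 < r → HasDerivAt h (h' r) r) {L R : ℝ}
    (hR : 0 < R) (hlim : Tendsto h (𝓝[>] 0) (𝓝 L)) (hn : ∀ r, 0 < r → r < R → 0 ≤ h' r) :
    L ≤ h R := by
  refine le_of_tendsto hlim ?_
  filter_upwards [Ioo_mem_nhdsGT hR] with r hr
  exact le_of_hasDerivAt_nonneg hd hr.1 hr.2.le fun t h1 h2 => hn t (hr.1.trans h1) h2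

lemma tendsto_pow_nhdsGT_zero {n : ℕ} (hn : n ≠ 0) :
    Tendsto (fun r : ℝ => r ^ n) (𝓝[>] 0) (𝓝 0) := by
  have : Tendsto (fun r : ℝ => r ^ n) (𝓝 0) (𝓝 (0 ^ n)) := (continuous_pow n).tendsto 0
  rw [zero_pow hn] at this
  exact this.mono_left nhdsWithin_le_nhds

end Monotonicity

/-- Radial profiles `u, v` of a positive solution of the critical system together with
`α = -u'/r` and `β = -v'/r`. -/
structure IsProfile (n : ℕ) (p q : ℝ) (u α v β : ℝ → ℝ) : Prop where
  hn : 3 ≤ n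
  hp : 0 < p
  hq : 0 < q
  hyp : 1 / (p + 1) + 1 / (q + 1) = ((n : ℝ) - 2) / n
  near : |(n : ℝ) / (q + 1) - n / (p + 1)| ≤ 1 / 20
  u_pos : ∀ r, 0 < u r
  v_pos : ∀ r, 0 < v r
  u_cont : Continuous u
  v_cont : Continuous v
  u_anti : ∀ r s, 0 ≤ r → r ≤ s → u s ≤ u r
  v_anti : ∀ r s, 0 ≤ r → r ≤ s → v s ≤ v r
  u_lim : Tendsto u atTop (𝓝 0)
  v_lim : Tendsto v atTop (𝓝 0)
  u_deriv : ∀ r, 0 < r → HasDerivAt u (r * -α r) r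
  v_deriv : ∀ r, 0 < r → HasDerivAt v (r * -β r) r
  α_deriv : ∀ r, 0 < r → HasDerivAt α (r * ((v r ^ p - n * α r) / r ^ 2)) r
  β_deriv : ∀ r, 0 < r → HasDerivAt β (r * ((u r ^ q - n * β r) / r ^ 2)) r
  α_lim : Tendsto α (𝓝[>] 0) (𝓝 (v 0 ^ p / n))
  β_lim : Tendsto β (𝓝[>] 0) (𝓝 (u 0 ^ q / n))

namespace IsProfile

variable {n : ℕ} {p q : ℝ} {u α v β : ℝ → ℝ}

lemma swap (h : IsProfile n p q u α v β) : IsProfile n q p v β u α where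
  hn := h.hn
  hp := h.hq
  hq := h.hp
  hyp := by rw [add_comm]; exact h.hyp
  near := by rw [abs_sub_comm]; exact h.near
  u_pos := h.v_pos
  v_pos := h.u_pos
  u_cont := h.v_cont
  v_cont := h.u_cont
  u_anti := h.v_anti
  v_anti := h.u_anti
  u_lim := h.v_lim
  v_lim := h.u_lim
  u_deriv := h.v_deriv
  v_deriv := h.u_deriv
  α_deriv := h.β_deriv
  β_deriv := h.α_deriv
  α_lim := h.β_lim
  β_lim := h.α_lim

lemma three_le (h : IsProfile n p q u α v β) : (3 : ℝ) ≤ n := by exact_mod_cast h.hn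

lemma exponent_sum (h : IsProfile n p q u α v β) :
    (n : ℝ) / (q + 1) + n / (p + 1) = n - 2 := by
  have h1 := h.hyp
  have hn := h.three_le
  have h2 : (n : ℝ) / (q + 1) + n / (p + 1) = n * (1 / (p + 1) + 1 / (q + 1)) := by ring
  rw [h2, h1]
  field_simp

lemma exponent_pos (h : IsProfile n p q u α v β) : 0 < (n : ℝ) / (p + 1) := by
  have hn := h.three_le
  have := h.hp
  positivity

lemma exponent_mul (h : IsProfile n p q u α v β) : (p + 1) * ((n : ℝ) / (p + 1)) = n := by
  have := h.hp
  field_simp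

lemma le_α (h : IsProfile n p q u α v β) {R : ℝ} (hR : 0 < R) : v R ^ p / n ≤ α R := by
  have hn := h.three_le
  have hd : ∀ r, 0 < r → HasDerivAt (fun r => r ^ n * (α r - v R ^ p / n))
      (r ^ (n - 1) * (v r ^ p - v R ^ p)) r := fun r hr => by
    refine ((hasDerivAt_pow n r).fun_mul ((h.α_deriv r hr).sub_const _)).congr_deriv ?_
    have h1 : r ^ n = r ^ (n - 1) * r := (pow_sub_one_mul (by have := h.hn; omega) r).symm
    rw [h1]
    field_simp
    ring
  have hlim : Tendsto (fun r => r ^ n * (α r - v R ^ p / n)) (𝓝[>] 0) (𝓝 0) := by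
    have h0 := tendsto_pow_nhdsGT_zero (n := n) (by have := h.hn; omega)
    simpa using h0.mul (h.α_lim.sub_const (v R ^ p / n))
  have := limit_le_of_hasDerivAt_nonneg hd hR hlim fun r hr hrR =>
    mul_nonneg (by positivity) (sub_nonneg.2 (Real.rpow_le_rpow (h.v_pos R).le
      (h.v_anti r R hr.le hrR.le) h.hp.le))
  have hpos : 0 < R ^ n := by positivity
  have h2 := nonneg_of_mul_nonneg_right this hpos
  linarith

lemma α_pos (h : IsProfile n p q u α v β) {r : ℝ} (hr : 0 < r) : 0 < α r := by
  have hn := h.three_le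
  exact (div_pos (Real.rpow_pos_of_pos (h.v_pos r) p) (by positivity)).trans_le (h.le_α hr)

lemma sq_mul_α_le (h : IsProfile n p q u α v β) {r : ℝ} (hr : 0 < r) :
    r ^ 2 * α r ≤ (n - 2) * u r := by
  by_contra! hcon
  have hn := h.three_le
  set c := r ^ 2 * α r - (n - 2) * u r with hc
  have hc0 : 0 < c := by linarith
  have hk : ∀ s, 0 < s → HasDerivAt (fun s => s ^ 2 * α s - (n - 2) * u s) (s * v s ^ p) s :=
    fun s hs => by
      refine (((hasDerivAt_pow 2 s).fun_mul (h.α_deriv s hs)).fun_sub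
        ((h.u_deriv s hs).const_mul _)).congr_deriv ?_
      field_simp
      ring
  have hge : ∀ s, r ≤ s → c ≤ s ^ 2 * α s := fun s hs => by
    have h1 := le_of_hasDerivAt_nonneg hk hr hs fun t h1 _ =>
      mul_nonneg (hr.trans h1).le (Real.rpow_nonneg (h.v_pos t).le p)
    have h2 := mul_nonneg (by linarith : (0 : ℝ) ≤ n - 2) (h.u_pos s).le
    beta_reduce at h1
    linarith
  have hl : ∀ s, 0 < s → HasDerivAt (fun s => u s + c * Real.log s) (s * -α s + c * s⁻¹) s :=
    fun s hs => (h.u_deriv s hs).add ((Real.hasDerivAt_log hs.ne').const_mul c)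
  have hle : ∀ s, r ≤ s → c * Real.log s ≤ u r + c * Real.log r := fun s hs => by
    have h1 := ge_of_hasDerivAt_nonpos hl hr hs fun t h1 _ => by
      have ht := hr.trans h1
      have h2 := hge t h1.le
      have h3 : t * -α t + c * t⁻¹ = t⁻¹ * (c - t ^ 2 * α t) := by field_simp; ring
      rw [h3]
      exact mul_nonpos_of_nonneg_of_nonpos (by positivity) (by linarith)
    have := h.u_pos s
    beta_reduce at h1
    linarith
  have ht : Tendsto (fun s => c * Real.log s) atTop atTop :=
    Real.tendsto_log_atTop.const_mul_atTop hc0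
  obtain ⟨s, hs1, hs2⟩ := ((ht.eventually_gt_atTop (u r + c * Real.log r)).and
    (eventually_ge_atTop r)).exists
  exact absurd (hle s hs2) (not_le.2 hs1)

/-- The Pohozaev identity for the ground state. -/
lemma pohozaev (h : IsProfile n p q u α v β) {R : ℝ} (hR : 0 < R) :
    R ^ 2 * α R * β R + u R ^ (q + 1) / (q + 1) + v R ^ (p + 1) / (p + 1)
      - n / (p + 1) * (α R * v R) - n / (q + 1) * (u R * β R) = 0 := by
  set E : ℝ → ℝ := fun r => r ^ 2 * α r * β r + u r ^ (q + 1) / (q + 1)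
    + v r ^ (p + 1) / (p + 1) - n / (p + 1) * (α r * v r) - n / (q + 1) * (u r * β r) with hE
  have hp := h.hp
  have hq := h.hq
  have hsum := h.exponent_sum
  have hd : ∀ r, 0 < r → HasDerivAt (fun r => r ^ n * E r) 0 r := fun r hr => by
    have hu := h.u_deriv r hr
    have hv := h.v_deriv r hr
    have hα := h.α_deriv r hr
    have hβ := h.β_deriv r hr
    have d1 := ((hasDerivAt_pow 2 r).fun_mul hα).fun_mul hβ
    have d2 := (hu.rpow_const (p := q + 1) (Or.inl (h.u_pos r).ne')).div_const (q + 1)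
    have d3 := (hv.rpow_const (p := p + 1) (Or.inl (h.v_pos r).ne')).div_const (p + 1)
    have d4 := (hα.fun_mul hv).const_mul ((n : ℝ) / (p + 1))
    have d5 := (hu.fun_mul hβ).const_mul ((n : ℝ) / (q + 1))
    refine ((hasDerivAt_pow n r).fun_mul
      ((((d1.fun_add d2).fun_add d3).fun_sub d4).fun_sub d5)).congr_deriv ?_
    have h1 : r ^ n = r ^ (n - 1) * r := (pow_sub_one_mul (by have := h.hn; omega) r).symm
    rw [add_sub_cancel_right, add_sub_cancel_right, Real.rpow_add_one (h.u_pos r).ne',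
      Real.rpow_add_one (h.v_pos r).ne', h1]
    generalize u r ^ q = X
    generalize v r ^ p = Y
    obtain ⟨s, hs⟩ : ∃ s, s = (n : ℝ) / (q + 1) := ⟨_, rfl⟩
    obtain ⟨t, ht⟩ : ∃ t, t = (n : ℝ) / (p + 1) := ⟨_, rfl⟩
    have hs' : s = n - 2 - t := by rw [hs, ht]; linarith
    have e1 : n * (X * u r / (q + 1)) = s * (X * u r) := by rw [hs]; ring
    have e2 : n * (Y * v r / (p + 1)) = t * (Y * v r) := by rw [ht]; ring
    rw [← hs, ← ht]
    have e3 : r * -α r * (q + 1) * X / (q + 1) = - r * α r * X := by field_simp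
    have e4 : r * -β r * (p + 1) * Y / (p + 1) = - r * β r * Y := by field_simp
    rw [e3, e4]
    have e5 : ∀ Z W : ℝ, r * ((Z - n * W) / r ^ 2) = (Z - n * W) / r := fun Z W => by field_simp
    rw [e5, e5]
    have e6 : ∀ S : ℝ, n * r ^ (n - 1) * S + r ^ (n - 1) * r * (-(n * S) / r) = 0 := fun S => by
      field_simp; ring
    refine Eq.trans ?_ (e6 (r ^ 2 * α r * β r + X * u r / (q + 1) + Y * v r / (p + 1) -
      t * (α r * v r) - s * (u r * β r)))
    congr 2
    have e7 : n * (r ^ 2 * α r * β r + X * u r / (q + 1) + Y * v r / (p + 1) -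
        t * (α r * v r) - s * (u r * β r)) = n * (r ^ 2 * α r * β r) + s * (X * u r)
          + t * (Y * v r) - n * (t * (α r * v r)) - n * (s * (u r * β r)) := by
      linear_combination e1 + e2
    rw [e7, hs']
    field_simp
    push_cast
    ring
  have hlimE : Tendsto (fun r => r ^ n * E r) (𝓝[>] 0) (𝓝 0) := by
    have h0 := tendsto_pow_nhdsGT_zero (n := n) (by have := h.hn; omega)
    have hu := (h.u_cont.tendsto 0).mono_left (nhdsWithin_le_nhds (s := Set.Ioi 0))
    have hv := (h.v_cont.tendsto 0).mono_left (nhdsWithin_le_nhds (s := Set.Ioi 0))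
    have hr : Tendsto (fun r : ℝ => r ^ 2) (𝓝[>] 0) (𝓝 (0 ^ 2)) :=
      ((continuous_pow 2).tendsto 0).mono_left nhdsWithin_le_nhds
    have := h0.mul ((((((hr.mul h.α_lim).mul h.β_lim).add
      ((hu.rpow_const (p := q + 1) (Or.inl (h.u_pos 0).ne')).div_const (q + 1))).add
      ((hv.rpow_const (p := p + 1) (Or.inl (h.v_pos 0).ne')).div_const (p + 1))).sub
      ((h.α_lim.mul hv).const_mul ((n : ℝ) / (p + 1)))).sub
      ((hu.mul h.β_lim).const_mul ((n : ℝ) / (q + 1))))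
    rw [zero_mul] at this
    exact this
  have hpos : 0 < R ^ n := by positivity
  have l1 := limit_le_of_hasDerivAt_nonneg hd hR hlimE fun _ _ _ => le_rfl
  have l2 := limit_le_of_hasDerivAt_nonneg (fun r hr => (hd r hr).fun_neg) hR
    (by simpa using hlimE.neg) fun _ _ _ => by simp
  have l3 : R ^ n * E R = 0 := by linarith
  exact (mul_eq_zero.1 l3).resolve_left hpos.ne'

end IsProfile

namespace IsProfile

variable {n : ℕ} {p q : ℝ} {u α v β : ℝ → ℝ}

/-- The logarithmic slope `-r u'/u`, scaled by `(q + 1)/n`. -/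
noncomputable def ratio (n : ℕ) (q : ℝ) (u α : ℝ → ℝ) (r : ℝ) : ℝ :=
  r ^ 2 * α r / (n / (q + 1) * u r)

lemma ratio_pos (h : IsProfile n p q u α v β) {r : ℝ} (hr : 0 < r) : 0 < ratio n q u α r := by
  have h1 := h.swap.exponent_pos
  have h2 := h.u_pos r
  have h3 := h.α_pos hr
  rw [ratio]
  positivity

lemma ratio_deriv (h : IsProfile n p q u α v β) {r : ℝ} (hr : 0 < r) :
    HasDerivAt (ratio n q u α) ((r ^ 2 * v r ^ p / (n / (q + 1) * u r)
      - (n - 2) * ratio n q u α r + n / (q + 1) * ratio n q u α r ^ 2) / r) r := by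
  have h1 := h.swap.exponent_pos
  have h2 := h.u_pos r
  have := ((hasDerivAt_pow 2 r).fun_mul (h.α_deriv r hr)).fun_div
    ((h.u_deriv r hr).const_mul ((n : ℝ) / (q + 1))) (by positivity)
  refine this.congr_deriv ?_
  simp only [ratio]
  generalize (n : ℝ) / (q + 1) = s at *
  field_simp
  push_cast
  ring

lemma ratio_source_sum (h : IsProfile n p q u α v β) {r : ℝ} (hr : 0 < r) :
    r ^ 2 * v r ^ p / (n / (q + 1) * u r) + r ^ 2 * u r ^ q / (n / (p + 1) * v r) =
      n * (ratio n q u α r + ratio n p v β r - ratio n q u α r * ratio n p v β r) := by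
  have h1 := h.swap.exponent_pos
  have h1' := h.exponent_pos
  have h2 := h.u_pos r
  have h3 := h.v_pos r
  have hP := h.pohozaev hr
  have hn := h.three_le
  rw [Real.rpow_add_one h2.ne', Real.rpow_add_one h3.ne'] at hP
  have hp := h.hp
  have hq := h.hq
  obtain ⟨s, hs⟩ : ∃ s, s = (n : ℝ) / (q + 1) := ⟨_, rfl⟩
  obtain ⟨t, ht⟩ : ∃ t, t = (n : ℝ) / (p + 1) := ⟨_, rfl⟩
  have e1 : n * (u r ^ q * u r / (q + 1)) = s * (u r ^ q * u r) := by rw [hs]; ring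
  have e2 : n * (v r ^ p * v r / (p + 1)) = t * (v r ^ p * v r) := by rw [ht]; ring
  simp only [ratio]
  rw [← hs] at h1 hP ⊢
  rw [← ht] at h1' hP ⊢
  clear hs ht
  field_simp
  linear_combination n * hP - e1 - e2

lemma ratio_add_deriv (h : IsProfile n p q u α v β) {r : ℝ} (hr : 0 < r) :
    ∃ D, HasDerivAt (fun r => ratio n q u α r + ratio n p v β r) D r ∧
      2 * (ratio n q u α r + ratio n p v β r)
        - 501 / 1000 * (ratio n q u α r + ratio n p v β r) ^ 2 ≤ r * D := by
  refine ⟨_, (h.ratio_deriv hr).fun_add (h.swap.ratio_deriv hr), ?_⟩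
  have hs := h.ratio_source_sum hr
  have hn := h.three_le
  have hsum := h.exponent_sum
  have hnear := abs_le.1 h.near
  generalize ratio n q u α r = x at *
  generalize ratio n p v β r = y at *
  generalize r ^ 2 * v r ^ p / (n / (q + 1) * u r) = X at *
  generalize r ^ 2 * u r ^ q / (n / (p + 1) * v r) = Y at *
  obtain ⟨δ, hδ⟩ : ∃ δ, δ = (n : ℝ) / (q + 1) - n / (p + 1) := ⟨_, rfl⟩
  have e1 : (n : ℝ) / (q + 1) = (n - 2 + δ) / 2 := by linarith
  have e2 : (n : ℝ) / (p + 1) = (n - 2 - δ) / 2 := by linarith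
  rw [← hδ] at hnear
  rw [e1, e2, ← add_div, mul_div_cancel₀ _ hr.ne']
  have hδ2 : δ ^ 2 ≤ 1 / 400 := by nlinarith
  nlinarith [sq_nonneg ((x - y) + δ * (x + y) / 4),
    mul_nonneg (sub_nonneg.2 hδ2) (sq_nonneg (x + y)),
    mul_nonneg (sub_nonneg.2 hn) (sq_nonneg (x - y)), sq_nonneg (x + y)]

lemma exists_ratio_add_ge (h : IsProfile n p q u α v β) :
    ∃ R, 0 < R ∧ ∀ r, R ≤ r → 39 / 10 ≤ ratio n q u α r + ratio n p v β r := by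
  set S : ℝ → ℝ := fun r => ratio n q u α r + ratio n p v β r with hS
  have hpos : ∀ r, 0 < r → 0 < S r := fun r hr => add_pos (h.ratio_pos hr) (h.swap.ratio_pos hr)
  choose! D hD hDle using fun r hr => h.ratio_add_deriv (r := r) hr
  have hW : ∀ r, 0 < r → HasDerivAt (fun r => r ^ 2 * ((S r)⁻¹ - 501 / 2000))
      (r / S r ^ 2 * (2 * S r - 501 / 1000 * S r ^ 2 - r * D r)) r := fun r hr => by
    have hs := hpos r hr
    refine ((hasDerivAt_pow 2 r).fun_mul (((hD r hr).fun_inv hs.ne').sub_const _)).congr_deriv ?_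
    change _ * (((S r)⁻¹) - _) + _ * (- D r / S r ^ 2) = _
    field_simp
    push_cast
    ring
  set C := (1 : ℝ) ^ 2 * ((S 1)⁻¹ - 501 / 2000) with hC
  have hle : ∀ r, 1 ≤ r → r ^ 2 * ((S r)⁻¹ - 501 / 2000) ≤ C := fun r hr =>
    ge_of_hasDerivAt_nonpos hW one_pos hr fun t ht _ => by
      have ht0 := one_pos.trans ht
      have h1 := hDle t ht0
      have h2 := hpos t ht0
      exact mul_nonpos_of_nonneg_of_nonpos (by positivity) (by linarith)
  refine ⟨max 1 (1000 * |C|), by positivity, fun r hr => ?_⟩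
  have hr1 : 1 ≤ r := (le_max_left _ _).trans hr
  have hr2 : 1000 * |C| ≤ r := (le_max_right _ _).trans hr
  have h1 := hle r hr1
  have h2 : (S r)⁻¹ - 501 / 2000 ≤ 1 / 1000 := by
    by_contra! hcon
    have h3 := le_abs_self C
    have h4 : r ≤ r ^ 2 := by nlinarith
    have h5 : r ^ 2 * (1 / 1000) < r ^ 2 * ((S r)⁻¹ - 501 / 2000) :=
      mul_lt_mul_of_pos_left hcon (by positivity)
    linarith
  have h3 : (S r)⁻¹ ≤ (39 / 10)⁻¹ := by norm_num at h2 ⊢; linarith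
  exact (inv_le_inv₀ (hpos r (by linarith)) (by norm_num)).1 h3

/-- The potentials of the linearized system decay faster than `r⁻²`. -/
lemma exists_potential_le (h : IsProfile n p q u α v β) :
    ∃ R C, 0 < R ∧ ∀ r, R ≤ r → v r ^ (p - 1) * r ^ 3 ≤ C := by
  obtain ⟨R, hR, hS⟩ := h.exists_ratio_add_ge
  have hd : ∀ r, 0 < r → HasDerivAt (fun r => v r ^ (p - 1) * r ^ 3)
      (v r ^ (p - 1) * r ^ 2 * (3 - (p - 1) * (r ^ 2 * β r / v r))) r := fun r hr => by
    have hv := h.v_pos r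
    refine (((h.v_deriv r hr).rpow_const (p := p - 1) (Or.inl hv.ne')).fun_mul
      (hasDerivAt_pow 3 r)).congr_deriv ?_
    rw [Real.rpow_sub_one hv.ne' (p - 1)]
    field_simp
    push_cast
    ring
  refine ⟨R, v R ^ (p - 1) * R ^ 3, hR, fun r hr =>
    ge_of_hasDerivAt_nonpos hd hR hr fun t ht _ => ?_⟩
  have ht0 := hR.trans ht
  have hv := h.v_pos t
  have hu := h.u_pos t
  refine mul_nonpos_of_nonneg_of_nonpos (by positivity) ?_
  have h1 := hS t ht.le
  have hs := h.swap.exponent_pos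
  have hτ := h.exponent_pos
  have hmul := h.exponent_mul
  have hsum := h.exponent_sum
  have hnear := abs_le.1 h.near
  have hn := h.three_le
  have h2 : n / (q + 1) * ratio n q u α t ≤ n - 2 := by
    have h3 := h.sq_mul_α_le ht0
    have h4 : n / (q + 1) * ratio n q u α t = t ^ 2 * α t / u t := by
      rw [ratio, ← mul_div_assoc, mul_div_mul_left _ _ hs.ne']
    rw [h4, div_le_iff₀ hu]
    exact h3
  have h3 : t ^ 2 * β t / v t = n / (p + 1) * ratio n p v β t := by
    rw [ratio, ← mul_div_assoc, mul_div_mul_left _ _ hτ.ne']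
  rw [h3]
  generalize ratio n q u α t = x at *
  generalize ratio n p v β t = y at *
  generalize (n : ℝ) / (q + 1) = s at *
  generalize (n : ℝ) / (p + 1) = τ at *
  have h5 : (p - 1) * (τ * y) = (2 + (s - τ)) * y := by
    linear_combination y * hmul - y * hsum
  have h6 : x ≤ 40 / 19 := by nlinarith
  rw [h5]
  nlinarith

end IsProfile

lemma HasSecondDerivAt.mul {k k₁ m m₁ : ℝ → ℝ} {K M t₀ : ℝ}
    (hk : ∀ᶠ t in 𝓝 t₀, HasDerivAt k (k₁ t) t) (hk₁ : HasDerivAt k₁ K t₀)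
    (hm : ∀ᶠ t in 𝓝 t₀, HasDerivAt m (m₁ t) t) (hm₁ : HasDerivAt m₁ M t₀) :
    HasSecondDerivAt (fun t => k t * m t) (K * m t₀ + 2 * k₁ t₀ * m₁ t₀ + k t₀ * M) t₀ := by
  refine ⟨fun t => k₁ t * m t + k t * m₁ t, ?_, ?_⟩
  · filter_upwards [hk, hm] with t h1 h2 using h1.fun_mul h2
  · exact ((hk₁.fun_mul hm.self_of_nhds).fun_add (hk.self_of_nhds.fun_mul hm₁)).congr_deriv
      (by ring)

lemma hasDerivAt_sqrt_mul {a b t : ℝ} (ha : 0 < a + t) (hb : 0 < b) :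
    HasDerivAt (fun t => √((a + t) * b)) (√((a + t) * b) * (2 * (a + t))⁻¹) t := by
  have h := (((hasDerivAt_id t).const_add a).mul_const b).sqrt (mul_pos ha hb).ne'
  refine h.congr_deriv ?_
  have h2 := Real.sqrt_pos.2 (mul_pos ha hb)
  simp only [id]
  rw [one_mul]
  field_simp
  exact (Real.sq_sqrt (mul_pos hb ha).le).symm

lemma hasDerivAt_sqrt_mul_inv {a b : ℝ} (ha : 0 < a) (hb : 0 < b) :
    HasDerivAt (fun t => √((a + t) * b) * (2 * (a + t))⁻¹) (-√(a * b) / (4 * a ^ 2)) 0 := by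
  have h := (hasDerivAt_sqrt_mul (t := 0) (by simpa using ha) hb).fun_mul
    ((((hasDerivAt_id (0 : ℝ)).const_add a).const_mul 2).fun_inv (by simpa using ha.ne'))
  refine h.congr_deriv ?_
  simp only [id, add_zero]
  field_simp
  ring

section SqrtWeight

variable {n : ℕ} {A A₁ A₂ : ℝ → ℝ}

/-- Second derivatives of `√(xᵢ xⱼ) A(‖x‖)` along coordinate lines. -/
lemma hasSecondDerivAt_sqrt_mul_radial (hA : ∀ r, 0 < r → HasDerivAt A (r * A₁ r) r)
    (hA₁ : ∀ r, 0 < r → HasDerivAt A₁ (r * A₂ r) r) {i j : Fin n} (hij : i ≠ j) {x : Euc n}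
    (hi : 0 < x i) (hj : 0 < x j) (k : Fin n) :
    HasSecondDerivAt (fun t : ℝ => √((x + t • stdVec k) i * (x + t • stdVec k) j) *
        A ‖x + t • stdVec k‖)
      (√(x i * x j) * (A₁ ‖x‖ + x k ^ 2 * A₂ ‖x‖)
        + (if k = i then √(x i * x j) * (A₁ ‖x‖ - A ‖x‖ / (4 * x i ^ 2)) else 0)
        + (if k = j then √(x i * x j) * (A₁ ‖x‖ - A ‖x‖ / (4 * x j ^ 2)) else 0)) 0 := by
  have hx : x ≠ 0 := fun h0 => by simp [h0] at hi
  have hm : ∀ k : Fin n, ∀ᶠ t : ℝ in 𝓝 0, HasDerivAt (fun t : ℝ => A ‖x + t • stdVec k‖)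
      ((x k + t) * A₁ ‖x + t • stdVec k‖) t := fun k => by
    filter_upwards [eventually_line_ne_zero hx (stdVec k)] with t ht
    exact hasDerivAt_radial_line hA ht
  have hm₁ : ∀ k : Fin n, HasDerivAt (fun t : ℝ => (x k + t) * A₁ ‖x + t • stdVec k‖)
      (A₁ ‖x‖ + x k ^ 2 * A₂ ‖x‖) 0 := fun k => by
    have h2 := ((hasDerivAt_id (0 : ℝ)).const_add (x k)).fun_mul
      (hasDerivAt_radial_line hA₁ (x := x) (i := k) (t := 0) (by simpa using hx))
    refine h2.congr_deriv ?_
    simp only [id, zero_smul, add_zero]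
    ring
  have hself : ∀ (k : Fin n) (t : ℝ), (x + t • (stdVec k : Euc n)) k = x k + t := fun k t => by
    simp
  have hother : ∀ {k l : Fin n} (t : ℝ), l ≠ k → (x + t • (stdVec k : Euc n)) l = x l :=
    fun t hkl => by simp [hkl]
  have hev : ∀ {a : ℝ}, 0 < a → ∀ᶠ t : ℝ in 𝓝 0, 0 < a + t := fun {a} ha => by
    have : Continuous fun t : ℝ => a + t := by fun_prop
    exact this.continuousAt.eventually_const_lt (by simpa using ha)
  by_cases hki : k = i
  · subst hki
    simp only [hself, hother _ hij.symm, if_neg hij, if_true]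
    have := HasSecondDerivAt.mul (m := fun t : ℝ => A ‖x + t • stdVec k‖)
      ((hev hi).mono fun t ht => hasDerivAt_sqrt_mul ht hj)
      (hasDerivAt_sqrt_mul_inv hi hj) (hm k) (hm₁ k)
    convert this using 1
    simp only [zero_smul, add_zero]
    field_simp
    ring
  · by_cases hkj : k = j
    · subst hkj
      simp only [hself, hother _ hij, if_neg hki, if_true]
      have := HasSecondDerivAt.mul (m := fun t : ℝ => A ‖x + t • stdVec k‖)
        ((hev hj).mono fun t ht => hasDerivAt_sqrt_mul ht hi)
        (hasDerivAt_sqrt_mul_inv hj hi) (hm k) (hm₁ k)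
      simp only [mul_comm (x i)]
      convert this using 1
      simp only [zero_smul, add_zero]
      field_simp
      ring
    · simp only [hother _ (Ne.symm hki), hother _ (Ne.symm hkj), if_neg hki, if_neg hkj, add_zero]
      exact HasSecondDerivAt.const_mul _ ⟨_, hm k, hm₁ k⟩

lemma sum_sqrt_mul_radial {i j : Fin n} (x : Euc n) (H a a₁ a₂ : ℝ) :
    ∑ k, (H * (a₁ + x k ^ 2 * a₂)
        + (if k = i then H * (a₁ - a / (4 * x i ^ 2)) else 0)
        + (if k = j then H * (a₁ - a / (4 * x j ^ 2)) else 0)) =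
      H * ((n + 2) * a₁ + ‖x‖ ^ 2 * a₂ - a / 4 * ((x i ^ 2)⁻¹ + (x j ^ 2)⁻¹)) := by
  rw [Finset.sum_add_distrib, Finset.sum_add_distrib, ← Finset.mul_sum, Finset.sum_add_distrib,
    ← Finset.sum_mul, ← EuclideanSpace.real_norm_sq_eq]
  simp only [Finset.sum_const, Finset.card_univ, Fintype.card_fin, nsmul_eq_mul,
    Finset.sum_ite_eq', Finset.mem_univ, if_true]
  simp only [div_eq_mul_inv, mul_inv]
  ring

end SqrtWeight

section Barrier

/-- A bounded radial function with strictly negative Laplacian of order `r ^ (-5/2)`. -/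
noncomputable def barrier (r : ℝ) : ℝ := 1 + (1 + r ^ 2) ^ (-(1 / 4) : ℝ)

lemma hasDerivAt_one_add_sq_rpow (c r : ℝ) : HasDerivAt (fun r : ℝ => (1 + r ^ 2) ^ c)
    (r * (2 * c * (1 + r ^ 2) ^ (c - 1))) r := by
  refine (((hasDerivAt_pow 2 r).const_add 1).rpow_const (p := c)
    (Or.inl (by positivity))).congr_deriv ?_
  push_cast
  ring

lemma barrier_deriv (r : ℝ) :
    HasDerivAt barrier (r * (-(1 / 2) * (1 + r ^ 2) ^ (-(5 / 4) : ℝ))) r := by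
  refine ((hasDerivAt_one_add_sq_rpow (-(1 / 4)) r).const_add 1).congr_deriv ?_
  norm_num

lemma barrier_deriv₁ (r : ℝ) : HasDerivAt (fun r => -(1 / 2) * (1 + r ^ 2) ^ (-(5 / 4) : ℝ))
    (r * (5 / 4 * (1 + r ^ 2) ^ (-(9 / 4) : ℝ))) r := by
  refine ((hasDerivAt_one_add_sq_rpow (-(5 / 4)) r).const_mul (-(1 / 2))).congr_deriv ?_
  norm_num
  ring

lemma one_le_barrier (r : ℝ) : 1 ≤ barrier r := by
  rw [barrier]
  have : 0 ≤ (1 + r ^ 2) ^ (-(1 / 4) : ℝ) := by positivity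
  linarith

lemma barrier_le_two (r : ℝ) : barrier r ≤ 2 := by
  rw [barrier]
  have := Real.rpow_le_one_of_one_le_of_nonpos (by nlinarith : 1 ≤ 1 + r ^ 2)
    (by norm_num : (-(1 / 4) : ℝ) ≤ 0)
  linarith

lemma barrier_lap_le {n : ℕ} (hn : (3 : ℝ) ≤ n) (r : ℝ) :
    n * (-(1 / 2) * (1 + r ^ 2) ^ (-(5 / 4) : ℝ)) + r ^ 2 * (5 / 4 * (1 + r ^ 2) ^ (-(9 / 4) : ℝ))
      ≤ -(1 / 4) * (1 + r ^ 2) ^ (-(5 / 4) : ℝ) := by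
  have h1 : 0 < 1 + r ^ 2 := by positivity
  have h2 : (1 + r ^ 2) ^ (-(5 / 4) : ℝ) = (1 + r ^ 2) ^ (-(9 / 4) : ℝ) * (1 + r ^ 2) := by
    rw [← Real.rpow_add_one h1.ne']
    norm_num
  have h3 : 0 < (1 + r ^ 2) ^ (-(9 / 4) : ℝ) := by positivity
  rw [h2]
  generalize (1 + r ^ 2) ^ (-(9 / 4) : ℝ) = w at *
  nlinarith [mul_nonneg h3.le (sq_nonneg r), mul_nonneg (mul_nonneg h3.le h1.le) (sub_nonneg.2 hn)]

lemma barrier_weight_ge {r : ℝ} (hr : 1 ≤ r) :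
    1 / (4 * r ^ 2 * √r) ≤ (1 + r ^ 2) ^ (-(5 / 4) : ℝ) := by
  have hr0 : 0 < r := by linarith
  rw [Real.rpow_neg (by positivity), one_div]
  refine inv_anti₀ (by positivity) ?_
  have h1 : (1 + r ^ 2) ^ (5 / 4 : ℝ) ≤ (2 * r ^ 2) ^ (5 / 4 : ℝ) :=
    Real.rpow_le_rpow (by positivity) (by nlinarith) (by norm_num)
  have h2 : (2 * r ^ 2) ^ (5 / 4 : ℝ) = 2 ^ (5 / 4 : ℝ) * (r ^ 2 * √r) := by
    rw [Real.mul_rpow (by norm_num) (by positivity), Real.sqrt_eq_rpow, ← Real.rpow_natCast r 2,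
      ← Real.rpow_mul hr0.le, ← Real.rpow_add hr0]
    norm_num
  have h3 : (2 : ℝ) ^ (5 / 4 : ℝ) ≤ 4 := by
    have := Real.rpow_le_rpow_of_exponent_le (by norm_num : (1 : ℝ) ≤ 2)
      (by norm_num : (5 / 4 : ℝ) ≤ 2)
    norm_num at this ⊢
    linarith
  have h4 : 0 ≤ r ^ 2 * √r := by positivity
  nlinarith

end Barrier

namespace IsProfile

variable {n : ℕ} {p q : ℝ} {u α v β : ℝ → ℝ}

/-- `α'/r`, expressed through the equation. -/
noncomputable def slope₁ (n : ℕ) (p : ℝ) (α v : ℝ → ℝ) (r : ℝ) : ℝ :=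
  (v r ^ p - n * α r) / r ^ 2

/-- `(α'/r)'/r`, expressed through the equation. -/
noncomputable def slope₂ (n : ℕ) (p : ℝ) (α v β : ℝ → ℝ) (r : ℝ) : ℝ :=
  (-(p * v r ^ (p - 1) * β r) - (n + 2) * slope₁ n p α v r) / r ^ 2

lemma slope₁_deriv (h : IsProfile n p q u α v β) (r : ℝ) (hr : 0 < r) :
    HasDerivAt (slope₁ n p α v) (r * slope₂ n p α v β r) r := by
  have hv := h.v_pos r
  refine ((((h.v_deriv r hr).rpow_const (p := p) (Or.inl hv.ne')).fun_sub
    ((h.α_deriv r hr).const_mul (n : ℝ))).fun_div (hasDerivAt_pow 2 r)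
    (by positivity)).congr_deriv ?_
  simp only [slope₂, slope₁]
  field_simp
  push_cast
  ring

lemma slope_equation {r : ℝ} (hr : 0 < r) :
    (n + 2) * slope₁ n p α v r + r ^ 2 * slope₂ n p α v β r = -(p * v r ^ (p - 1) * β r) := by
  rw [slope₂]
  field_simp
  ring

lemma one_lt (h : IsProfile n p q u α v β) : 1 < p := by
  have h1 := h.exponent_pos
  have h2 := h.exponent_mul
  have h3 := h.exponent_sum
  have h4 := abs_le.1 h.near
  by_contra! hp
  nlinarith

lemma potential_nonneg (h : IsProfile n p q u α v β) (r : ℝ) : 0 ≤ p * v r ^ (p - 1) :=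
  mul_nonneg h.hp.le (Real.rpow_nonneg (h.v_pos r).le _)

lemma potential_le (h : IsProfile n p q u α v β) {r : ℝ} (hr : 0 ≤ r) :
    p * v r ^ (p - 1) ≤ p * v 0 ^ (p - 1) :=
  mul_le_mul_of_nonneg_left (Real.rpow_le_rpow (h.v_pos r).le (h.v_anti 0 r le_rfl hr)
    (by linarith [h.one_lt])) h.hp.le

lemma exists_potential_le_barrier_weight (h : IsProfile n p q u α v β) :
    ∃ R, 0 < R ∧ ∀ r, R ≤ r →
      p * v r ^ (p - 1) * barrier r ≤ 1 / 4 * (1 + r ^ 2) ^ (-(5 / 4) : ℝ) := by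
  obtain ⟨R, C, hR, hC⟩ := h.exists_potential_le
  have hp := h.hp
  refine ⟨max R (max 1 ((32 * p * C) ^ 2)), by positivity, fun r hr => ?_⟩
  have hr1 : 1 ≤ r := (le_max_left _ _).trans ((le_max_right _ _).trans hr)
  have hr2 : (32 * p * C) ^ 2 ≤ r := (le_max_right _ _).trans ((le_max_right _ _).trans hr)
  have hr0 : 0 < r := by linarith
  have h1 := hC r ((le_max_left _ _).trans hr)
  have h2 : 32 * p * C ≤ √r := Real.le_sqrt_of_sq_le hr2
  have h3 := h.potential_nonneg r
  have h4 : p * v r ^ (p - 1) * barrier r ≤ p * v r ^ (p - 1) * 2 :=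
    mul_le_mul_of_nonneg_left (barrier_le_two r) h3
  refine h4.trans (le_trans ?_ (mul_le_mul_of_nonneg_left (barrier_weight_ge hr1) (by norm_num)))
  have hs : 0 < √r := Real.sqrt_pos.2 hr0
  have hss : √r * √r = r := Real.mul_self_sqrt hr0.le
  rw [mul_one_div, le_div_iff₀ (by positivity)]
  have h5 : p * (v r ^ (p - 1) * r ^ 3) ≤ p * C := mul_le_mul_of_nonneg_left h1 hp.le
  have h6 : (p * v r ^ (p - 1) * 2 * (4 * r ^ 2 * √r)) * √r ≤ 1 / 4 * √r := by
    calc (p * v r ^ (p - 1) * 2 * (4 * r ^ 2 * √r)) * √r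
        = 8 * (p * (v r ^ (p - 1) * (r ^ 2 * (√r * √r)))) := by ring
      _ = 8 * (p * (v r ^ (p - 1) * r ^ 3)) := by rw [hss]; ring
      _ ≤ 1 / 4 * √r := by linarith
  exact le_of_mul_le_mul_right h6 hs

lemma exists_barrier_coeff (h : IsProfile n p q u α v β) :
    ∃ η₀, 0 < η₀ ∧ ∀ η, 0 < η → η ≤ η₀ → ∀ r, 0 < r →
      η * (p * v r ^ (p - 1) * barrier r) <
        α r / (2 * r) + η * (1 / 4 * (1 + r ^ 2) ^ (-(5 / 4) : ℝ)) := by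
  obtain ⟨R, hR, hb⟩ := h.exists_potential_le_barrier_weight
  have hn := h.three_le
  have hvR := h.v_pos R
  have hv0 := h.v_pos 0
  have hp := h.hp
  set m := v R ^ p / n / (2 * R) with hm
  set M := p * v 0 ^ (p - 1) * 2 with hM
  have hm0 : 0 < m := by positivity
  have hM0 : 0 < M := by positivity
  refine ⟨m / M, by positivity, fun η hη hηle r hr => ?_⟩
  have hw : 0 < (1 + r ^ 2) ^ (-(5 / 4) : ℝ) := by positivity
  rcases le_total R r with hRr | hrR
  · have h1 := mul_le_mul_of_nonneg_left (hb r hRr) hη.le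
    have h2 : 0 < α r / (2 * r) := div_pos (h.α_pos hr) (by positivity)
    linarith
  · have h1 : m ≤ α r / (2 * r) := by
      refine div_le_div₀ (h.α_pos hr).le (le_trans ?_ (h.le_α hr)) (by positivity) (by linarith)
      exact div_le_div_of_nonneg_right
        (Real.rpow_le_rpow hvR.le (h.v_anti r R hr.le hrR) hp.le) (by positivity)
    have h2 : p * v r ^ (p - 1) * barrier r ≤ M :=
      mul_le_mul (h.potential_le hr.le) (barrier_le_two r)
        (by linarith [one_le_barrier r]) (by positivity)
    have h3 := mul_le_mul_of_nonneg_left h2 hη.le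
    have h4 := (le_div_iff₀ hM0).1 hηle
    have h5 := mul_pos hη hw
    linarith

lemma margin_ge {x y r a : ℝ} (hx : 0 < x) (hy : 0 < y) (hr : 0 < r) (hxy : x ^ 2 + y ^ 2 ≤ r ^ 2)
    (ha : 0 ≤ a) : a / (2 * r) ≤ √(x * y) * (a / 4 * ((x ^ 2)⁻¹ + (y ^ 2)⁻¹)) := by
  have hxy0 : 0 < x * y := mul_pos hx hy
  have hs : 0 < √(x * y) := Real.sqrt_pos.2 hxy0
  have hss : √(x * y) * √(x * y) = x * y := Real.mul_self_sqrt hxy0.le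
  have h1 : √(x * y) ≤ r := by
    rw [Real.sqrt_le_left hr.le]
    nlinarith [sq_nonneg (x - y)]
  have h2 : 2 / (x * y) ≤ (x ^ 2)⁻¹ + (y ^ 2)⁻¹ := by
    have := sq_nonneg (x⁻¹ - y⁻¹)
    have e : (x⁻¹ - y⁻¹) ^ 2 = (x ^ 2)⁻¹ + (y ^ 2)⁻¹ - 2 / (x * y) := by field_simp; ring
    linarith
  calc a / (2 * r) ≤ a / (2 * √(x * y)) :=
        div_le_div_of_nonneg_left ha (by positivity) (by linarith)
    _ = √(x * y) * (a / 4 * (2 / (x * y))) := by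
        generalize √(x * y) = s at *
        rw [← hss]
        field_simp
        ring
    _ ≤ _ := by gcongr

lemma isStrictSuperAt_barrier (h : IsProfile n p q u α v β) {i j : Fin n} (hij : i ≠ j) {η : ℝ}
    (hη : 0 < η)
    (hcoeff : ∀ r, 0 < r → η * (p * v r ^ (p - 1) * barrier r) <
        α r / (2 * r) + η * (1 / 4 * (1 + r ^ 2) ^ (-(5 / 4) : ℝ)))
    {x : Euc n} (hi : 0 < x i) (hj : 0 < x j) :
    IsStrictSuperAt (fun y : Euc n => √(y i * y j) * α ‖y‖ + η * barrier ‖y‖)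
      (fun y : Euc n => √(y i * y j) * β ‖y‖ + η * barrier ‖y‖)
      (fun y => p * v ‖y‖ ^ (p - 1)) x := by
  have hx : x ≠ 0 := fun h0 => by simp [h0] at hi
  have hr : 0 < ‖x‖ := norm_pos_iff.2 hx
  refine ⟨_, fun k => (hasSecondDerivAt_sqrt_mul_radial (A₁ := slope₁ n p α v) h.α_deriv
    h.slope₁_deriv hij hi hj k).add ((hasSecondDerivAt_radial_line (fun r _ => barrier_deriv r)
    (fun r _ => barrier_deriv₁ r) hx k).const_mul η), ?_⟩
  rw [Finset.sum_add_distrib, sum_sqrt_mul_radial, slope_equation hr, ← Finset.mul_sum,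
    Finset.sum_add_distrib, ← Finset.sum_mul _ _ (5 / 4 * _), ← EuclideanSpace.real_norm_sq_eq]
  simp only [Finset.sum_const, Finset.card_univ, Fintype.card_fin, nsmul_eq_mul]
  have hsq : x i ^ 2 + x j ^ 2 ≤ ‖x‖ ^ 2 := by
    rw [EuclideanSpace.real_norm_sq_eq, ← Finset.sum_pair (f := fun k => x k ^ 2) hij]
    exact Finset.sum_le_sum_of_subset_of_nonneg (Finset.subset_univ _) fun _ _ _ => sq_nonneg _
  have h1 := margin_ge hi hj hr hsq (h.α_pos hr).le
  have h2 := mul_le_mul_of_nonneg_left (barrier_lap_le h.three_le ‖x‖) hη.le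
  have h3 := hcoeff _ hr
  linarith

lemma quadrant_nonpos (h : IsProfile n p q u α v β) {i j : Fin n} (hij : i ≠ j)
    {Φ Ψ : Euc n → ℝ} (hΦ : ContDiff ℝ 2 Φ) (hΨ : ContDiff ℝ 2 Ψ)
    (h₁ : ∀ x, -lap Φ x = p * v ‖x‖ ^ (p - 1) * Ψ x)
    (h₂ : ∀ x, -lap Ψ x = q * u ‖x‖ ^ (q - 1) * Φ x)
    (hdΦ : Tendsto Φ (cocompact _) (𝓝 0)) (hdΨ : Tendsto Ψ (cocompact _) (𝓝 0))
    (hbΦ : ∀ x : Euc n, x i = 0 ∨ x j = 0 → Φ x = 0)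
    (hbΨ : ∀ x : Euc n, x i = 0 ∨ x j = 0 → Ψ x = 0) {x : Euc n} (hi : 0 < x i) (hj : 0 < x j) :
    Φ x ≤ 0 ∧ Ψ x ≤ 0 := by
  obtain ⟨η₁, hη₁, hc₁⟩ := h.exists_barrier_coeff
  obtain ⟨η₂, hη₂, hc₂⟩ := h.swap.exists_barrier_coeff
  set η := min η₁ η₂ with hη
  have hη0 : 0 < η := lt_min hη₁ hη₂
  have hci : ∀ k : Fin n, Continuous fun y : Euc n => y k := fun k => by fun_prop
  set Ω : Set (Euc n) := {y | 0 < y i} ∩ {y | 0 < y j} with hΩ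
  have hopen : IsOpen Ω :=
    (isOpen_lt continuous_const (hci i)).inter (isOpen_lt continuous_const (hci j))
  have hbd : ∀ y ∈ closure Ω, y ∉ Ω → y i = 0 ∨ y j = 0 := fun y hy hyn => by
    have hcl : IsClosed ({y : Euc n | 0 ≤ y i} ∩ {y | 0 ≤ y j}) :=
      (isClosed_le continuous_const (hci i)).inter (isClosed_le continuous_const (hci j))
    have hy' := closure_minimal
      (fun z (hz : z ∈ Ω) => (⟨Set.mem_ofPred.2 (le_of_lt hz.1), Set.mem_ofPred.2 (le_of_lt hz.2)⟩ :
        z ∈ ({y : Euc n | 0 ≤ y i} ∩ {y | 0 ≤ y j}))) hcl hy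
    by_contra! hne
    exact hyn ⟨lt_of_le_of_ne hy'.1 hne.1.symm, lt_of_le_of_ne hy'.2 hne.2.symm⟩
  have hne : ∀ y ∈ Ω, 0 < ‖y‖ := fun y hy => norm_pos_iff.2 fun h0 => by
    have : 0 < y i := hy.1
    simp [h0] at this
  have hcont : ∀ {A A' : ℝ → ℝ}, (∀ r, 0 < r → HasDerivAt A (A' r) r) →
      ContinuousOn (fun y : Euc n => √(y i * y j) * A ‖y‖ + η * barrier ‖y‖) Ω :=
    fun {A A'} hA y hy => by
      have c1 : ContinuousAt (fun y : Euc n => √(y i * y j)) y :=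
        (((hci i).mul (hci j)).sqrt).continuousAt
      have c2 : ContinuousAt (fun y : Euc n => A ‖y‖) y :=
        ContinuousAt.comp (f := fun y : Euc n => ‖y‖) (hA _ (hne y hy)).continuousAt
          continuous_norm.continuousAt
      have c3 : ContinuousAt (fun y : Euc n => barrier ‖y‖) y :=
        ContinuousAt.comp (f := fun y : Euc n => ‖y‖) (barrier_deriv _).continuousAt
          continuous_norm.continuousAt
      exact ((c1.mul c2).add (c3.const_mul η)).continuousWithinAt
  have hge : ∀ {A : ℝ → ℝ}, (∀ r, 0 < r → 0 < A r) → ∀ y ∈ Ω,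
      η ≤ √(y i * y j) * A ‖y‖ + η * barrier ‖y‖ := fun {A} hA y hy => by
    have h1 := mul_nonneg (Real.sqrt_nonneg (y i * y j)) (hA _ (hne y hy)).le
    have h2 := mul_le_mul_of_nonneg_left (one_le_barrier ‖y‖) hη0.le
    linarith
  exact nonpos_of_strict_super hopen hΦ hΨ h₁ h₂ (fun y => h.potential_nonneg _)
    (fun y => h.swap.potential_nonneg _) (fun y hy hyn => hbΦ y (hbd y hy hyn))
    (fun y hy hyn => hbΨ y (hbd y hy hyn)) hdΦ hdΨ hη0
    (hge fun r hr => h.α_pos hr) (hge fun r hr => h.swap.α_pos hr)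
    (hcont h.α_deriv) (hcont h.β_deriv)
    (fun y hy => h.isStrictSuperAt_barrier hij hη0 (hc₁ η hη0 (min_le_left _ _)) hy.1 hy.2)
    (fun y hy => h.swap.isStrictSuperAt_barrier hij hη0 (hc₂ η hη0 (min_le_right _ _)) hy.1 hy.2)
    x ⟨hi, hj⟩

end IsProfile

/-- Decaying `C²` solutions of the system linearized at a radial pair. -/
structure LinSol (n : ℕ) (p q : ℝ) (u v : ℝ → ℝ) (φ ψ : Euc n → ℝ) : Prop where
  contDiff_left : ContDiff ℝ 2 φ
  contDiff_right : ContDiff ℝ 2 ψ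
  eq_left : ∀ x, -lap φ x = p * v ‖x‖ ^ (p - 1) * ψ x
  eq_right : ∀ x, -lap ψ x = q * u ‖x‖ ^ (q - 1) * φ x
  decay_left : Tendsto φ (cocompact _) (𝓝 0)
  decay_right : Tendsto ψ (cocompact _) (𝓝 0)

namespace LinSol

variable {n : ℕ} {p q : ℝ} {u v : ℝ → ℝ} {φ ψ φ' ψ' : Euc n → ℝ}

lemma swap (s : LinSol n p q u v φ ψ) : LinSol n q p v u ψ φ :=
  ⟨s.contDiff_right, s.contDiff_left, s.eq_right, s.eq_left, s.decay_right, s.decay_left⟩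

lemma add (s : LinSol n p q u v φ ψ) (s' : LinSol n p q u v φ' ψ') :
    LinSol n p q u v (fun x => φ x + φ' x) (fun x => ψ x + ψ' x) where
  contDiff_left := s.contDiff_left.add s'.contDiff_left
  contDiff_right := s.contDiff_right.add s'.contDiff_right
  eq_left x := by
    rw [lap_add s.contDiff_left s'.contDiff_left, neg_add, s.eq_left, s'.eq_left, mul_add]
  eq_right x := by
    rw [lap_add s.contDiff_right s'.contDiff_right, neg_add, s.eq_right, s'.eq_right, mul_add]
  decay_left := by simpa using s.decay_left.add s'.decay_left
  decay_right := by simpa using s.decay_right.add s'.decay_right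

lemma const_mul (c : ℝ) (s : LinSol n p q u v φ ψ) :
    LinSol n p q u v (fun x => c * φ x) (fun x => c * ψ x) where
  contDiff_left := contDiff_const.mul s.contDiff_left
  contDiff_right := contDiff_const.mul s.contDiff_right
  eq_left x := by
    rw [lap_const_mul c s.contDiff_left, ← mul_neg, s.eq_left]; ring
  eq_right x := by
    rw [lap_const_mul c s.contDiff_right, ← mul_neg, s.eq_right]; ring
  decay_left := by simpa using s.decay_left.const_mul c
  decay_right := by simpa using s.decay_right.const_mul c

lemma sub (s : LinSol n p q u v φ ψ) (s' : LinSol n p q u v φ' ψ') :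
    LinSol n p q u v (fun x => φ x - φ' x) (fun x => ψ x - ψ' x) := by
  simpa only [neg_one_mul, ← sub_eq_add_neg] using s.add (s'.const_mul (-1))

lemma comp_isometry (s : LinSol n p q u v φ ψ) (T : Euc n ≃ₗᵢ[ℝ] Euc n) :
    LinSol n p q u v (fun x => φ (T x)) (fun x => ψ (T x)) where
  contDiff_left := s.contDiff_left.comp T.contDiff
  contDiff_right := s.contDiff_right.comp T.contDiff
  eq_left x := by rw [lap_comp_isometry T s.contDiff_left, s.eq_left, T.norm_map]
  eq_right x := by rw [lap_comp_isometry T s.contDiff_right, s.eq_right, T.norm_map]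
  decay_left := s.decay_left.comp T.toHomeomorph.isClosedEmbedding.tendsto_cocompact
  decay_right := s.decay_right.comp T.toHomeomorph.isClosedEmbedding.tendsto_cocompact

end LinSol

/-- Reflection in the `i`-th coordinate. -/
noncomputable def reflectCoord {n : ℕ} (i : Fin n) : Euc n ≃ₗᵢ[ℝ] Euc n :=
  Submodule.reflection (ℝ ∙ (stdVec i : Euc n))ᗮ

lemma reflectCoord_apply {n : ℕ} (i : Fin n) (x : Euc n) :
    reflectCoord i x = x - (2 * x i) • stdVec i := by
  rw [reflectCoord, Submodule.reflection_orthogonal_apply, Submodule.reflection_singleton_apply]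
  simp [EuclideanSpace.inner_single_left, mul_smul, two_smul]

lemma exists_isometry_pair {n : ℕ} {i j : Fin n} (hij : i ≠ j) {e f : Euc n} (he : ‖e‖ = 1)
    (hf : ‖f‖ = 1) (hef : inner ℝ e f = 0) :
    ∃ T : Euc n ≃ₗᵢ[ℝ] Euc n, T (stdVec i) = e ∧ T (stdVec j) = f := by
  classical
  set w : Fin n → Euc n := fun k => if k = i then e else f with hw
  have hon : Orthonormal ℝ (({i, j} : Set (Fin n)).domRestrict w) := by
    constructor
    · rintro ⟨k, hk⟩
      by_cases h : k = i <;> simp [Set.domRestrict, hw, h, he, hf]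
    · rintro ⟨k, hk⟩ ⟨l, hl⟩ hkl
      have hkl' : k ≠ l := fun h => hkl (Subtype.ext h)
      rcases hk with rfl | hk
      · have hl' : l = j := hl.resolve_left (Ne.symm hkl')
        simp [Set.domRestrict, hw, hl', hij.symm, hef]
      · have hk' : k = j := hk
        have hl' : l = i := hl.resolve_right fun h => hkl' (hk'.trans h.symm)
        rw [real_inner_comm]
        simp [Set.domRestrict, hw, hk', hl', hij.symm, hef]
  obtain ⟨b, hb⟩ := hon.exists_orthonormalBasis_extension_of_card_eq (by simp)
  refine ⟨b.repr.symm, ?_, ?_⟩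
  · rw [b.repr_symm_single, hb i (by simp)]
    simp [hw]
  · rw [b.repr_symm_single, hb j (by simp)]
    simp [hw, hij.symm]

lemma inner_isometry_stdVec {n : ℕ} (T : Euc n ≃ₗᵢ[ℝ] Euc n) (i : Fin n) (x : Euc n) :
    inner ℝ (T (stdVec i)) (T x) = x i := by
  rw [T.inner_map_map, EuclideanSpace.inner_single_left]
  simp

namespace LinSol

variable {n : ℕ} {p q : ℝ} {u α v β : ℝ → ℝ} {φ ψ : Euc n → ℝ}

/-- The part of a solution that is odd in two coordinates vanishes. -/
lemma oddOdd_eq_zero (h : IsProfile n p q u α v β) (s : LinSol n p q u v φ ψ) {i j : Fin n}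
    (hij : i ≠ j) {x : Euc n} (hi : 0 < x i) (hj : 0 < x j) :
    φ x - φ (reflectCoord i x) - φ (reflectCoord j x)
      + φ (reflectCoord i (reflectCoord j x)) = 0 := by
  have hs := ((s.sub (s.comp_isometry (reflectCoord i))).sub
    (s.comp_isometry (reflectCoord j))).add
    ((s.comp_isometry (reflectCoord i)).comp_isometry (reflectCoord j))
  have hfix : ∀ (k : Fin n) (y : Euc n), y k = 0 → reflectCoord k y = y := fun k y hy => by
    simp [reflectCoord_apply, hy]
  have hcoord : ∀ y : Euc n, (reflectCoord j y) i = y i := fun y => by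
    simp [reflectCoord_apply, hij]
  have hb : ∀ (f : Euc n → ℝ) (y : Euc n), y i = 0 ∨ y j = 0 →
      f y - f (reflectCoord i y) - f (reflectCoord j y) +
        f (reflectCoord i (reflectCoord j y)) = 0 := fun f y hy => by
    rcases hy with hy | hy
    · rw [hfix i y hy, hfix i _ ((hcoord y).trans hy)]
      ring
    · rw [hfix j y hy]
      ring
  have h1 := h.quadrant_nonpos hij hs.contDiff_left hs.contDiff_right hs.eq_left hs.eq_right
    hs.decay_left hs.decay_right (hb φ) (hb ψ) hi hj
  have hs' := hs.const_mul (-1)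
  have h2 := h.quadrant_nonpos hij hs'.contDiff_left hs'.contDiff_right hs'.eq_left hs'.eq_right
    hs'.decay_left hs'.decay_right (fun y hy => by rw [hb φ y hy, mul_zero])
    (fun y hy => by rw [hb ψ y hy, mul_zero]) hi hj
  linarith [h1.1, h2.1]

/-- Sums over antipodal pairs of a sphere centred at `z` in `zᗮ` do not depend on the pair. -/
lemma antipodal_sum_eq (h : IsProfile n p q u α v β) (s : LinSol n p q u v φ ψ) {z a b : Euc n}
    (ha : inner ℝ z a = 0) (hb : inner ℝ z b = 0) (hab : ‖a‖ = ‖b‖) :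
    φ (z + a) + φ (z - a) = φ (z + b) + φ (z - b) := by
  by_cases hw1 : a - b = 0
  · rw [sub_eq_zero.1 hw1]
  by_cases hw2 : a + b = 0
  · rw [eq_neg_of_add_eq_zero_left hw2, sub_neg_eq_add, add_comm, ← sub_eq_add_neg]
  have hn := h.hn
  obtain ⟨i, j, hij⟩ : ∃ i j : Fin n, i ≠ j :=
    ⟨⟨0, by omega⟩, ⟨1, by omega⟩, by simp [Fin.ext_iff]⟩
  have n1 : 0 < ‖a - b‖ := norm_pos_iff.2 hw1
  have n2 : 0 < ‖a + b‖ := norm_pos_iff.2 hw2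
  have horth : inner ℝ (a - b) (a + b) = 0 := by
    rw [inner_sub_left, inner_add_right, inner_add_right, real_inner_comm a b,
      real_inner_self_eq_norm_sq, real_inner_self_eq_norm_sq, hab]
    ring
  obtain ⟨T, hT1, hT2⟩ := exists_isometry_pair hij (e := ‖a - b‖⁻¹ • (a - b))
    (f := ‖a + b‖⁻¹ • (a + b)) (norm_smul_inv_norm hw1) (norm_smul_inv_norm hw2)
    (by rw [inner_smul_left, inner_smul_right, horth]; simp)
  set x := T.symm (z + a) with hx
  have hTx : T x = z + a := T.apply_symm_apply _
  have hza : inner ℝ (a - b) (z + a) = ‖a - b‖ ^ 2 / 2 := by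
    rw [inner_add_right, real_inner_comm, inner_sub_right, ha, hb]
    rw [← real_inner_self_eq_norm_sq, inner_sub_left, inner_sub_left, inner_sub_right,
      inner_sub_right, real_inner_self_eq_norm_sq a, real_inner_self_eq_norm_sq b, hab,
      real_inner_comm a b]
    ring
  have hza' : inner ℝ (a + b) (z + a) = ‖a + b‖ ^ 2 / 2 := by
    rw [inner_add_right, real_inner_comm, inner_add_right, ha, hb]
    rw [← real_inner_self_eq_norm_sq, inner_add_left, inner_add_left, inner_add_right,
      inner_add_right, real_inner_self_eq_norm_sq a, real_inner_self_eq_norm_sq b, hab,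
      real_inner_comm a b]
    ring
  have hxi : x i = ‖a - b‖ / 2 := by
    rw [← inner_isometry_stdVec T, hTx, hT1, inner_smul_left, hza]
    simp only [map_inv₀, conj_trivial]
    field_simp
  have hxj : x j = ‖a + b‖ / 2 := by
    rw [← inner_isometry_stdVec T, hTx, hT2, inner_smul_left, hza']
    simp only [map_inv₀, conj_trivial]
    field_simp
  have hT1' : ∀ y : Euc n, y i = ‖a - b‖ / 2 → T (reflectCoord i y) = T y - (a - b) :=
    fun y hy => by
      rw [reflectCoord_apply, map_sub, map_smul, hT1, hy, smul_smul]
      congr 1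
      rw [show 2 * (‖a - b‖ / 2) * ‖a - b‖⁻¹ = 1 by field_simp, one_smul]
  have hT2' : T (reflectCoord j x) = T x - (a + b) := by
    rw [reflectCoord_apply, map_sub, map_smul, hT2, hxj, smul_smul]
    congr 1
    rw [show 2 * (‖a + b‖ / 2) * ‖a + b‖⁻¹ = 1 by field_simp, one_smul]
  have hyi : (reflectCoord j x) i = ‖a - b‖ / 2 := by
    rw [← hxi]
    simp [reflectCoord_apply, hij]
  have key := oddOdd_eq_zero h (s.comp_isometry T) hij (x := x) (by rw [hxi]; positivity)
    (by rw [hxj]; positivity)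
  rw [hT1' x hxi, hT1' _ hyi, hT2', hTx] at key
  rw [show z + a - (a - b) = z + b by abel, show z + a - (a + b) = z - b by abel,
    show z - b - (a - b) = z - a by abel] at key
  linarith

end LinSol

lemma nonpos_of_midpoint {k : ℝ → ℝ} {R : ℝ} (hR : 0 ≤ R) (hk : ContinuousOn k (Set.Icc (-R) R))
    (hmid : ∀ c ∈ Set.Icc (-R) R, ∀ d ∈ Set.Icc (-R) R, k c + k d = 2 * k ((c + d) / 2))
    (hleft : k (-R) = 0) (hright : k R = 0) {c : ℝ} (hc : c ∈ Set.Icc (-R) R) : k c ≤ 0 := by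
  obtain ⟨m, hm, hmax⟩ := isCompact_Icc.exists_isMaxOn ⟨c, hc⟩ hk
  refine (hmax hc).trans ?_
  rcases le_total m 0 with h0 | h0
  · have hd : 2 * m + R ∈ Set.Icc (-R) R := ⟨by linarith [hm.1], by linarith⟩
    have h1 := hmid (-R) ⟨le_rfl, by linarith⟩ _ hd
    have h2 : k (2 * m + R) ≤ k m := hmax hd
    rw [show (-R + (2 * m + R)) / 2 = m by ring, hleft] at h1
    change k m ≤ 0
    linarith
  · have hd : 2 * m - R ∈ Set.Icc (-R) R := ⟨by linarith, by linarith [hm.2]⟩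
    have h1 := hmid R ⟨by linarith, le_rfl⟩ _ hd
    have h2 : k (2 * m - R) ≤ k m := hmax hd
    rw [show (R + (2 * m - R)) / 2 = m by ring, hright] at h1
    change k m ≤ 0
    linarith

section OddFunctions

variable {n : ℕ} {χ : Euc n → ℝ}

lemma inner_stdVec {i j : Fin n} :
    inner ℝ (stdVec i : Euc n) (stdVec j) = if i = j then 1 else 0 := by
  rw [EuclideanSpace.inner_single_left]
  by_cases h : i = j
  · simp [h]
  · simp [h]

lemma sum_pair_midpoint
    (hC : ∀ z a b : Euc n, inner ℝ z a = 0 → inner ℝ z b = 0 → ‖a‖ = ‖b‖ →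
      χ (z + a) + χ (z - a) = χ (z + b) + χ (z - b))
    {i j l : Fin n} (hij : i ≠ j) (hil : i ≠ l) (hjl : j ≠ l) {c s d t S R : ℝ}
    (hs : c ^ 2 + s ^ 2 = R ^ 2) (ht : d ^ 2 + t ^ 2 = R ^ 2)
    (hS : ((c + d) / 2) ^ 2 + S ^ 2 = R ^ 2) :
    (χ (c • stdVec i + s • stdVec j) + χ (c • stdVec i - s • stdVec j)) +
      (χ (d • stdVec i + t • stdVec j) + χ (d • stdVec i - t • stdVec j)) =
    2 * (χ (((c + d) / 2) • stdVec i + S • stdVec j)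
      + χ (((c + d) / 2) • stdVec i - S • stdVec j)) := by
  set e : Euc n := stdVec i
  set f : Euc n := stdVec j
  set g : Euc n := stdVec l
  have ee : inner ℝ e e = 1 := by simp [e]
  have ff : inner ℝ f f = 1 := by simp [f]
  have gg : inner ℝ g g = 1 := by simp [g]
  have ef : inner ℝ e f = 0 := by simp [e, f, inner_stdVec, hij]
  have fe : inner ℝ f e = 0 := by simp [e, f, inner_stdVec, hij.symm]
  have eg : inner ℝ e g = 0 := by simp [e, g, inner_stdVec, hil]
  have ge : inner ℝ g e = 0 := by simp [e, g, inner_stdVec, hil.symm]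
  have fg : inner ℝ f g = 0 := by simp [f, g, inner_stdVec, hjl]
  have gf : inner ℝ g f = 0 := by simp [f, g, inner_stdVec, hjl.symm]
  have hin : ∀ a₁ a₂ a₃ b₁ b₂ b₃ : ℝ, inner ℝ (a₁ • e + a₂ • f + a₃ • g)
      (b₁ • e + b₂ • f + b₃ • g) = a₁ * b₁ + a₂ * b₂ + a₃ * b₃ := fun a₁ a₂ a₃ b₁ b₂ b₃ => by
    simp only [inner_add_left, inner_add_right, real_inner_smul_left, real_inner_smul_right,
      ee, ff, gg, ef, fe, eg, ge, fg, gf]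
    ring
  have hC' : ∀ z₁ z₂ a₁ a₂ a₃ b₁ b₂ b₃ : ℝ, z₁ * a₁ + z₂ * a₂ = 0 → z₁ * b₁ + z₂ * b₂ = 0 →
      a₁ ^ 2 + a₂ ^ 2 + a₃ ^ 2 = b₁ ^ 2 + b₂ ^ 2 + b₃ ^ 2 →
      χ ((z₁ + a₁) • e + (z₂ + a₂) • f + a₃ • g) + χ ((z₁ - a₁) • e + (z₂ - a₂) • f + -a₃ • g) =
      χ ((z₁ + b₁) • e + (z₂ + b₂) • f + b₃ • g)
        + χ ((z₁ - b₁) • e + (z₂ - b₂) • f + -b₃ • g) := by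
    intro z₁ z₂ a₁ a₂ a₃ b₁ b₂ b₃ h1 h2 h3
    have := hC (z₁ • e + z₂ • f + (0 : ℝ) • g) (a₁ • e + a₂ • f + a₃ • g)
      (b₁ • e + b₂ • f + b₃ • g) (by rw [hin]; linarith) (by rw [hin]; linarith) (by
        rw [← sq_eq_sq₀ (norm_nonneg _) (norm_nonneg _), ← real_inner_self_eq_norm_sq,
          ← real_inner_self_eq_norm_sq, hin, hin]
        linarith)
    convert this using 3 <;> module
  have hform : ∀ x y : ℝ, x • e + y • f = x • e + y • f + (0 : ℝ) • g := fun x y => by module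
  have hform' : ∀ x y : ℝ, x • e - y • f = x • e + (-y) • f + (0 : ℝ) • g := fun x y => by module
  rw [hform c s, hform' c s, hform d t, hform' d t, hform ((c + d) / 2) S, hform' ((c + d) / 2) S]
  set ρ := √(((c - d) / 2) ^ 2 + ((s - t) / 2) ^ 2) with hρ
  have hρ2 : ρ ^ 2 = ((c - d) / 2) ^ 2 + ((s - t) / 2) ^ 2 := Real.sq_sqrt (by positivity)
  have k1 := hC' ((c + d) / 2) ((s + t) / 2) ((c - d) / 2) ((s - t) / 2) 0 0 0 ρ
    (by linear_combination (hs - ht) / 4) (by ring) (by linear_combination -hρ2)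
  have k2 := hC' ((c + d) / 2) (-((s + t) / 2)) ((c - d) / 2) (-((s - t) / 2)) 0 0 0 ρ
    (by linear_combination (hs - ht) / 4) (by ring) (by linear_combination -hρ2)
  have k3 := hC' ((c + d) / 2) 0 0 ((s + t) / 2) ρ 0 S 0 (by ring) (by ring)
    (by linear_combination hρ2 - hS + (hs + ht) / 2)
  have k4 := hC' ((c + d) / 2) 0 0 ((s + t) / 2) (-ρ) 0 S 0 (by ring) (by ring)
    (by linear_combination hρ2 - hS + (hs + ht) / 2)
  ring_nf at k1 k2 k3 k4 ⊢
  linarith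

/-- An odd function with the antipodal sum property is linear along each sphere, after
symmetrization. -/
lemma sum_pair_eq (hc : Continuous χ) (hodd : ∀ x, χ (-x) = -χ x)
    (hC : ∀ z a b : Euc n, inner ℝ z a = 0 → inner ℝ z b = 0 → ‖a‖ = ‖b‖ →
      χ (z + a) + χ (z - a) = χ (z + b) + χ (z - b))
    {i j l : Fin n} (hij : i ≠ j) (hil : i ≠ l) (hjl : j ≠ l) {c s R : ℝ} (hR : 0 < R)
    (hs : c ^ 2 + s ^ 2 = R ^ 2) :
    χ (c • stdVec i + s • stdVec j) + χ (c • stdVec i - s • stdVec j) =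
      2 * (c / R) * χ (R • stdVec i) := by
  have habs : ∀ c ∈ Set.Icc (-R) R, c ^ 2 + √(R ^ 2 - c ^ 2) ^ 2 = R ^ 2 := fun c hc => by
    rw [Real.sq_sqrt (sub_nonneg.2 (sq_le_sq' hc.1 hc.2))]
    ring
  set k : ℝ → ℝ := fun c => χ (c • stdVec i + √(R ^ 2 - c ^ 2) • stdVec j)
    + χ (c • stdVec i - √(R ^ 2 - c ^ 2) • stdVec j) - 2 * (c / R) * χ (R • stdVec i) with hk
  have hkc : Continuous k := by
    have h1 : Continuous fun c : ℝ => √(R ^ 2 - c ^ 2) := by fun_prop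
    fun_prop
  have hmid : ∀ c ∈ Set.Icc (-R) R, ∀ d ∈ Set.Icc (-R) R, k c + k d = 2 * k ((c + d) / 2) :=
    fun c hc d hd => by
      have := sum_pair_midpoint hC hij hil hjl (habs c hc) (habs d hd)
        (habs ((c + d) / 2) ⟨by linarith [hc.1, hd.1], by linarith [hc.2, hd.2]⟩)
      simp only [hk]
      linear_combination this
  have hright : k R = 0 := by
    simp only [hk, sub_self, Real.sqrt_zero, zero_smul, add_zero, sub_zero, div_self hR.ne']
    ring
  have hleft : k (-R) = 0 := by
    simp only [hk, neg_sq, sub_self, Real.sqrt_zero, zero_smul, add_zero, sub_zero, neg_smul,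
      hodd, neg_div, div_self hR.ne']
    ring
  have hzero : ∀ c ∈ Set.Icc (-R) R, k c = 0 := fun c hc => by
    refine le_antisymm (nonpos_of_midpoint hR.le hkc.continuousOn hmid hleft hright hc) ?_
    have := nonpos_of_midpoint (k := fun c => -k c) hR.le hkc.neg.continuousOn
      (fun c hc d hd => by linear_combination -(hmid c hc d hd)) (by simp [hleft])
      (by simp [hright]) hc
    linarith
  have hcR : c ∈ Set.Icc (-R) R := by
    rw [Set.mem_Icc, ← abs_le]
    exact abs_le_of_sq_le_sq (by nlinarith [sq_nonneg s]) hR.le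
  have hk0 := hzero c hcR
  have hsq : √(R ^ 2 - c ^ 2) = |s| := by
    rw [show R ^ 2 - c ^ 2 = s ^ 2 by linarith, Real.sqrt_sq_eq_abs]
  simp only [hk, hsq] at hk0
  rcases abs_choice s with h | h <;> rw [h] at hk0
  · linarith
  · rw [neg_smul, ← sub_eq_add_neg, sub_neg_eq_add] at hk0
    linarith

end OddFunctions

/-- Radial form of a linear cooperative system in dimension `d`, with `μ₁ = μ'/r`, `ν₁ = ν'/r`. -/
structure RadialSol (d : ℕ) (C : ℝ) (c₁ c₂ μ μ₁ ν ν₁ : ℝ → ℝ) : Prop where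
  d_pos : 1 ≤ d
  c₁_nonneg : ∀ r, 0 < r → 0 ≤ c₁ r
  c₂_nonneg : ∀ r, 0 < r → 0 ≤ c₂ r
  c₁_le : ∀ r, 0 < r → c₁ r ≤ C
  c₂_le : ∀ r, 0 < r → c₂ r ≤ C
  μ_deriv : ∀ r, 0 < r → HasDerivAt μ (r * μ₁ r) r
  ν_deriv : ∀ r, 0 < r → HasDerivAt ν (r * ν₁ r) r
  μ₁_deriv : ∀ r, 0 < r → HasDerivAt μ₁ ((-(c₁ r * ν r) - d * μ₁ r) / r) r
  ν₁_deriv : ∀ r, 0 < r → HasDerivAt ν₁ ((-(c₂ r * μ r) - d * ν₁ r) / r) r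
  μ₁_lim : Tendsto (fun r => r ^ d * μ₁ r) (𝓝[>] 0) (𝓝 0)
  ν₁_lim : Tendsto (fun r => r ^ d * ν₁ r) (𝓝[>] 0) (𝓝 0)

namespace RadialSol

variable {d : ℕ} {C : ℝ} {c₁ c₂ μ μ₁ ν ν₁ : ℝ → ℝ}

lemma swap (h : RadialSol d C c₁ c₂ μ μ₁ ν ν₁) : RadialSol d C c₂ c₁ ν ν₁ μ μ₁ :=
  ⟨h.d_pos, h.c₂_nonneg, h.c₁_nonneg, h.c₂_le, h.c₁_le, h.ν_deriv, h.μ_deriv, h.ν₁_deriv,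
    h.μ₁_deriv, h.ν₁_lim, h.μ₁_lim⟩

lemma neg (h : RadialSol d C c₁ c₂ μ μ₁ ν ν₁) : RadialSol d C c₁ c₂ (fun r => -μ r)
    (fun r => -μ₁ r) (fun r => -ν r) (fun r => -ν₁ r) where
  d_pos := h.d_pos
  c₁_nonneg := h.c₁_nonneg
  c₂_nonneg := h.c₂_nonneg
  c₁_le := h.c₁_le
  c₂_le := h.c₂_le
  μ_deriv r hr := (h.μ_deriv r hr).fun_neg.congr_deriv (by ring)
  ν_deriv r hr := (h.ν_deriv r hr).fun_neg.congr_deriv (by ring)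
  μ₁_deriv r hr := (h.μ₁_deriv r hr).fun_neg.congr_deriv (by ring)
  ν₁_deriv r hr := (h.ν₁_deriv r hr).fun_neg.congr_deriv (by ring)
  μ₁_lim := by simpa using h.μ₁_lim.neg
  ν₁_lim := by simpa using h.ν₁_lim.neg

lemma pow_mul_deriv (h : RadialSol d C c₁ c₂ μ μ₁ ν ν₁) (k r : ℝ) (hr : 0 < r) :
    HasDerivAt (fun r => r ^ d * (k - μ₁ r)) (r ^ (d - 1) * (d * k + c₁ r * ν r)) r := by
  refine ((hasDerivAt_pow d r).fun_mul ((h.μ₁_deriv r hr).const_sub k)).congr_deriv ?_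
  have h1 : r ^ d = r ^ (d - 1) * r := (pow_sub_one_mul (by have := h.d_pos; omega) r).symm
  rw [h1]
  field_simp
  ring

lemma pow_mul_lim (h : RadialSol d C c₁ c₂ μ μ₁ ν ν₁) (k : ℝ) :
    Tendsto (fun r => r ^ d * (k - μ₁ r)) (𝓝[>] 0) (𝓝 0) := by
  have h0 := tendsto_pow_nhdsGT_zero (n := d) (by have := h.d_pos; omega)
  simpa [mul_sub] using (h0.mul_const k).sub h.μ₁_lim

/-- If `ν` is bounded below near the origin then `μ₁` is bounded above there. -/
lemma μ₁_le (h : RadialSol d C c₁ c₂ μ μ₁ ν ν₁) {k R : ℝ} (hR : 0 < R)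
    (hk : ∀ r, 0 < r → r < R → 0 ≤ d * k + c₁ r * ν r) : μ₁ R ≤ k := by
  have := limit_le_of_hasDerivAt_nonneg (h.pow_mul_deriv k) hR (h.pow_mul_lim k) fun r hr hrR =>
    mul_nonneg (by positivity) (hk r hr hrR)
  have h2 := nonneg_of_mul_nonneg_right this (by positivity)
  linarith

lemma tendsto_mul_μ₁ (h : RadialSol d C c₁ c₂ μ μ₁ ν ν₁) (hν : Tendsto ν (𝓝[>] 0) (𝓝 0)) :
    Tendsto (fun r => r * μ₁ r) (𝓝[>] 0) (𝓝 0) := by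
  have hC : 0 ≤ C := (h.c₁_nonneg 1 one_pos).trans (h.c₁_le 1 one_pos)
  have hd : (1 : ℝ) ≤ d := by exact_mod_cast h.d_pos
  have hev : ∀ᶠ r in 𝓝[>] (0 : ℝ), |ν r| < 1 := by
    have := hν.abs
    rw [abs_zero] at this
    exact this.eventually_lt_const one_pos
  obtain ⟨R, hR, hb⟩ := mem_nhdsGT_iff_exists_Ioo_subset.1 hev
  have hR' : (0 : ℝ) < R := hR
  have hbound : ∀ r, 0 < r → r < R → |μ₁ r| ≤ C := fun r hr hrR => by
    have hcν : ∀ t, 0 < t → t < r → |c₁ t * ν t| ≤ C := fun t ht htr => by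
      rw [abs_mul, abs_of_nonneg (h.c₁_nonneg t ht)]
      have h1 : |ν t| < 1 := hb ⟨ht, htr.trans hrR⟩
      have h2 := mul_le_mul (h.c₁_le t ht) h1.le (abs_nonneg _) hC
      linarith
    rw [abs_le']
    constructor
    · refine h.μ₁_le hr fun t ht htr => ?_
      have := (abs_le.1 (hcν t ht htr)).1
      nlinarith
    · refine h.neg.μ₁_le hr fun t ht htr => ?_
      have := (abs_le.1 (hcν t ht htr)).2
      have e : d * C + c₁ t * -ν t = d * C - c₁ t * ν t := by ring
      rw [e]
      nlinarith
  have hz : Tendsto (fun r : ℝ => r * C) (𝓝[>] 0) (𝓝 0) := by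
    have : Tendsto (fun r : ℝ => r * C) (𝓝 0) (𝓝 (0 * C)) :=
      (continuous_id.mul continuous_const).tendsto 0
    rw [zero_mul] at this
    exact this.mono_left nhdsWithin_le_nhds
  refine squeeze_zero_norm' ?_ hz
  filter_upwards [Ioo_mem_nhdsGT hR'] with r hr
  rw [Real.norm_eq_abs, abs_mul, abs_of_pos hr.1]
  exact mul_le_mul_of_nonneg_left (hbound r hr.1 hr.2) hr.1.le

/-- Uniqueness for the Cauchy problem at the origin. -/
lemma eq_zero_of_tendsto_zero (h : RadialSol d C c₁ c₂ μ μ₁ ν ν₁)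
    (hμ : Tendsto μ (𝓝[>] 0) (𝓝 0)) (hν : Tendsto ν (𝓝[>] 0) (𝓝 0)) {R : ℝ} (hR : 0 < R) :
    μ R = 0 ∧ ν R = 0 := by
  have hC : 0 ≤ C := (h.c₁_nonneg 1 one_pos).trans (h.c₁_le 1 one_pos)
  have hd : (1 : ℝ) ≤ d := by exact_mod_cast h.d_pos
  set G : ℝ → ℝ := fun r => μ r ^ 2 + ν r ^ 2 + (r * μ₁ r) ^ 2 + (r * ν₁ r) ^ 2 with hG
  set K := 1 + C with hK
  have hm : ∀ r, 0 < r → HasDerivAt (fun r => r * μ₁ r) (-(c₁ r * ν r) - (d - 1) * μ₁ r) r :=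
    fun r hr => ((hasDerivAt_id r).fun_mul (h.μ₁_deriv r hr)).congr_deriv (by
      simp only [id]
      field_simp
      ring)
  have hm' : ∀ r, 0 < r → HasDerivAt (fun r => r * ν₁ r) (-(c₂ r * μ r) - (d - 1) * ν₁ r) r :=
    fun r hr => ((hasDerivAt_id r).fun_mul (h.ν₁_deriv r hr)).congr_deriv (by
      simp only [id]
      field_simp
      ring)
  have hGd : ∀ r, 0 < r → HasDerivAt (fun r => -(G r * Real.exp (-(K * r))))
      (Real.exp (-(K * r)) * (K * G r - (2 * μ r * (r * μ₁ r) + 2 * ν r * (r * ν₁ r)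
        + 2 * (r * μ₁ r) * (-(c₁ r * ν r) - (d - 1) * μ₁ r)
        + 2 * (r * ν₁ r) * (-(c₂ r * μ r) - (d - 1) * ν₁ r)))) r := fun r hr => by
    have d1 := ((((h.μ_deriv r hr).fun_pow 2).fun_add ((h.ν_deriv r hr).fun_pow 2)).fun_add
      ((hm r hr).fun_pow 2)).fun_add ((hm' r hr).fun_pow 2)
    have d2 := ((hasDerivAt_id r).const_mul K).fun_neg.exp
    refine (d1.fun_mul d2).fun_neg.congr_deriv ?_
    simp only [id, hG]
    push_cast
    ring
  have hlim : Tendsto (fun r => -(G r * Real.exp (-(K * r)))) (𝓝[>] 0) (𝓝 0) := by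
    have h1 := h.tendsto_mul_μ₁ hν
    have h2 := h.swap.tendsto_mul_μ₁ hμ
    have h3 : Tendsto (fun r : ℝ => Real.exp (-(K * r))) (𝓝[>] 0) (𝓝 (Real.exp (-(K * 0)))) :=
      ((by fun_prop : Continuous fun r : ℝ => Real.exp (-(K * r))).tendsto 0).mono_left
        nhdsWithin_le_nhds
    simpa using (((((hμ.pow 2).add (hν.pow 2)).add (h1.pow 2)).add (h2.pow 2)).mul h3).neg
  have hle := limit_le_of_hasDerivAt_nonneg hGd hR hlim fun r hr _ => by
    refine mul_nonneg (Real.exp_pos _).le ?_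
    have k1 : 0 ≤ (d - 1) * (r * μ₁ r ^ 2) :=
      mul_nonneg (by linarith) (mul_nonneg hr.le (sq_nonneg _))
    have k2 : 0 ≤ (d - 1) * (r * ν₁ r ^ 2) :=
      mul_nonneg (by linarith) (mul_nonneg hr.le (sq_nonneg _))
    have hc1 := h.c₁_nonneg r hr
    have hc2 := h.c₂_nonneg r hr
    have k3 : c₁ r * ((r * μ₁ r) ^ 2 + ν r ^ 2) ≤ C * ((r * μ₁ r) ^ 2 + ν r ^ 2) :=
      mul_le_mul_of_nonneg_right (h.c₁_le r hr) (by positivity)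
    have k4 : c₂ r * ((r * ν₁ r) ^ 2 + μ r ^ 2) ≤ C * ((r * ν₁ r) ^ 2 + μ r ^ 2) :=
      mul_le_mul_of_nonneg_right (h.c₂_le r hr) (by positivity)
    have k5 := mul_nonneg hc1 (sq_nonneg (r * μ₁ r + ν r))
    have k6 := mul_nonneg hc2 (sq_nonneg (r * ν₁ r + μ r))
    simp only [hG, hK]
    nlinarith [sq_nonneg (μ r - r * μ₁ r), sq_nonneg (ν r - r * ν₁ r)]
  have hexp := Real.exp_pos (-(K * R))
  have hG0 : G R ≤ 0 := by
    by_contra! hcon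
    have := mul_pos hcon hexp
    linarith
  have a1 := sq_nonneg (μ R)
  have a2 := sq_nonneg (ν R)
  have a3 := sq_nonneg (R * μ₁ R)
  have a4 := sq_nonneg (R * ν₁ R)
  simp only [hG] at hG0
  exact ⟨by nlinarith, by nlinarith⟩

/-- A solution with `μ(0) = 0 < ν(0)` stays bounded away from zero. -/
lemma false_of_pos (h : RadialSol d C c₁ c₂ μ μ₁ ν ν₁) {b : ℝ} (hb : 0 < b)
    (hμ : Tendsto μ (𝓝[>] 0) (𝓝 0)) (hν : Tendsto ν (𝓝[>] 0) (𝓝 b))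
    (hinf : Tendsto ν atTop (𝓝 0)) : False := by
  have claim : ∀ R, 0 < R → (∀ r, 0 < r → r < R → 0 ≤ ν r) → b ≤ ν R := fun R hR hpos => by
    have s1 : ∀ r, 0 < r → r ≤ R → μ₁ r ≤ 0 := fun r hr hrR => h.μ₁_le hr fun t ht htr => by
      have := mul_nonneg (h.c₁_nonneg t ht) (hpos t ht (by linarith))
      simpa using this
    have s2 : ∀ r, 0 < r → r ≤ R → μ r ≤ 0 := fun r hr hrR => by
      have := limit_le_of_hasDerivAt_nonneg (fun t ht => (h.μ_deriv t ht).fun_neg) hr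
        (by simpa using hμ.neg) fun t ht htr => by
          have := s1 t ht (by linarith)
          nlinarith
      linarith
    have s3 : ∀ r, 0 < r → r ≤ R → 0 ≤ ν₁ r := fun r hr hrR => by
      have := h.swap.neg.μ₁_le (k := 0) hr fun t ht htr => by
        have h1 := s2 t ht (by linarith)
        have h2 := mul_nonneg (h.c₂_nonneg t ht) (neg_nonneg.2 h1)
        simpa using h2
      linarith
    exact limit_le_of_hasDerivAt_nonneg h.ν_deriv hR hν fun t ht htR =>
      mul_nonneg ht.le (s3 t ht htR.le)
  set S : Set ℝ := {r | 0 < r ∧ ν r < b / 2} with hS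
  have hne : S.Nonempty := by
    obtain ⟨r, h1, h2⟩ := ((hinf.eventually_lt_const (half_pos hb)).and
      (eventually_gt_atTop 0)).exists
    exact ⟨r, h2, h1⟩
  have hbdd : BddBelow S := ⟨0, fun r hr => hr.1.le⟩
  obtain ⟨ε, hε, hεb⟩ := mem_nhdsGT_iff_exists_Ioo_subset.1
    (hν.eventually_const_lt (half_lt_self hb))
  have hε0 : (0 : ℝ) < ε := hε
  have hR0 : ε ≤ sInf S := le_csInf hne fun r hr => by
    by_contra! hlt
    have : b / 2 < ν r := hεb ⟨hr.1, hlt⟩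
    linarith [hr.2]
  set R := sInf S
  have hR : 0 < R := hε0.trans_le hR0
  have hge : ∀ r, 0 < r → r < R → 0 ≤ ν r := fun r hr hrR => by
    by_contra! hlt
    exact absurd (csInf_le hbdd (⟨hr, by linarith⟩ : r ∈ S)) (not_le.2 hrR)
  have hbR := claim R hR hge
  have hcont : ∀ᶠ r in 𝓝 R, b / 2 < ν r :=
    (h.ν_deriv R hR).continuousAt.eventually_const_lt (by linarith)
  obtain ⟨l, u', ⟨hl, hu⟩, hsub⟩ := mem_nhds_iff_exists_Ioo_subset.1 hcont
  obtain ⟨r, hrS, hru⟩ := exists_lt_of_csInf_lt hne hu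
  have hr1 : l < r := hl.trans_le (csInf_le hbdd hrS)
  have : b / 2 < ν r := hsub ⟨hr1, hru⟩
  linarith [hrS.2]

lemma eq_zero (h : RadialSol d C c₁ c₂ μ μ₁ ν ν₁) {b : ℝ}
    (hμ : Tendsto μ (𝓝[>] 0) (𝓝 0)) (hν : Tendsto ν (𝓝[>] 0) (𝓝 b))
    (hinf : Tendsto ν atTop (𝓝 0)) {r : ℝ} (hr : 0 < r) : μ r = 0 ∧ ν r = 0 := by
  rcases lt_trichotomy b 0 with hb | hb | hb
  · exact (h.neg.false_of_pos (neg_pos.2 hb) (by simpa using hμ.neg) hν.neg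
      (by simpa using hinf.neg)).elim
  · exact h.eq_zero_of_tendsto_zero hμ (hb ▸ hν) hr
  · exact (h.false_of_pos hb hμ hν hinf).elim

end RadialSol

lemma RadialSol.sub_const_mul {d : ℕ} {C : ℝ} {c₁ c₂ μ μ₁ ν ν₁ κ κ₁ ω ω₁ : ℝ → ℝ}
    (h : RadialSol d C c₁ c₂ μ μ₁ ν ν₁) (h' : RadialSol d C c₁ c₂ κ κ₁ ω ω₁) (c : ℝ) :
    RadialSol d C c₁ c₂ (fun r => μ r - c * κ r) (fun r => μ₁ r - c * κ₁ r)
      (fun r => ν r - c * ω r) (fun r => ν₁ r - c * ω₁ r) where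
  d_pos := h.d_pos
  c₁_nonneg := h.c₁_nonneg
  c₂_nonneg := h.c₂_nonneg
  c₁_le := h.c₁_le
  c₂_le := h.c₂_le
  μ_deriv r hr := ((h.μ_deriv r hr).fun_sub ((h'.μ_deriv r hr).const_mul c)).congr_deriv (by ring)
  ν_deriv r hr := ((h.ν_deriv r hr).fun_sub ((h'.ν_deriv r hr).const_mul c)).congr_deriv (by ring)
  μ₁_deriv r hr :=
    ((h.μ₁_deriv r hr).fun_sub ((h'.μ₁_deriv r hr).const_mul c)).congr_deriv (by ring)
  ν₁_deriv r hr :=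
    ((h.ν₁_deriv r hr).fun_sub ((h'.ν₁_deriv r hr).const_mul c)).congr_deriv (by ring)
  μ₁_lim := by
    have := h.μ₁_lim.sub (h'.μ₁_lim.const_mul c)
    rw [mul_zero, sub_zero] at this
    exact this.congr fun r => by ring
  ν₁_lim := by
    have := h.ν₁_lim.sub (h'.ν₁_lim.const_mul c)
    rw [mul_zero, sub_zero] at this
    exact this.congr fun r => by ring

namespace IsProfile

variable {n : ℕ} {p q : ℝ} {u α v β : ℝ → ℝ}

/-- A common bound for the two potentials of the linearized system. -/
noncomputable def potentialBound (p q : ℝ) (u v : ℝ → ℝ) : ℝ :=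
  p * v 0 ^ (p - 1) + q * u 0 ^ (q - 1)

lemma potential_le_bound (h : IsProfile n p q u α v β) (r : ℝ) (hr : 0 < r) :
    p * v r ^ (p - 1) ≤ potentialBound p q u v := by
  have h1 := h.potential_le hr.le
  have h2 := h.swap.potential_nonneg 0
  rw [potentialBound]
  linarith

lemma potential_le_bound' (h : IsProfile n p q u α v β) (r : ℝ) (hr : 0 < r) :
    q * u r ^ (q - 1) ≤ potentialBound p q u v := by
  have h1 := h.swap.potential_le hr.le
  have h2 := h.potential_nonneg 0
  rw [potentialBound]
  linarith

/-- The radial profile of the derivative of the solution along the scaling family. -/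
noncomputable def scaling (n : ℕ) (q : ℝ) (u α : ℝ → ℝ) (r : ℝ) : ℝ :=
  n / (q + 1) * u r - r ^ 2 * α r

lemma scaling_deriv (h : IsProfile n p q u α v β) (r : ℝ) (hr : 0 < r) :
    HasDerivAt (scaling n q u α) (r * (n / (p + 1) * α r - v r ^ p)) r := by
  refine (((h.u_deriv r hr).const_mul (n / (q + 1) : ℝ)).fun_sub
    ((hasDerivAt_pow 2 r).fun_mul (h.α_deriv r hr))).congr_deriv ?_
  have h1 : (n : ℝ) / (p + 1) = n - 2 - n / (q + 1) := by linarith [h.exponent_sum]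
  rw [h1]
  field_simp
  push_cast
  ring

lemma scaling_slope_deriv (h : IsProfile n p q u α v β) (r : ℝ) (hr : 0 < r) :
    HasDerivAt (fun r => n / (p + 1) * α r - v r ^ p)
      ((-(p * v r ^ (p - 1) * scaling n p v β r) - n * (n / (p + 1) * α r - v r ^ p)) / r) r := by
  have hv := h.v_pos r
  refine (((h.α_deriv r hr).const_mul (n / (p + 1) : ℝ)).fun_sub
    ((h.v_deriv r hr).rpow_const (p := p) (Or.inl hv.ne'))).congr_deriv ?_
  have hvp : v r ^ p = v r ^ (p - 1) * v r := by
    rw [← Real.rpow_add_one hv.ne', sub_add_cancel]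
  have hp := h.hp
  have hm := h.exponent_mul
  rw [scaling, hvp]
  generalize (n : ℝ) / (p + 1) = τ at *
  rw [← hm]
  field_simp
  ring

lemma scaling_tendsto_zero (h : IsProfile n p q u α v β) :
    Tendsto (scaling n q u α) (𝓝[>] 0) (𝓝 (n / (q + 1) * u 0)) := by
  have h1 : Tendsto u (𝓝[>] 0) (𝓝 (u 0)) := h.u_cont.continuousAt.tendsto.mono_left inf_le_left
  have h2 := tendsto_pow_nhdsGT_zero (n := 2) (by norm_num)
  have h3 := (h1.const_mul (n / (q + 1) : ℝ)).sub (h2.mul h.α_lim)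
  rwa [zero_mul, sub_zero] at h3

lemma tendsto_sq_mul (h : IsProfile n p q u α v β) :
    Tendsto (fun r => r ^ 2 * α r) atTop (𝓝 0) := by
  refine tendsto_of_tendsto_of_tendsto_of_le_of_le' tendsto_const_nhds
    (by simpa using h.u_lim.const_mul ((n : ℝ) - 2)) ?_ ?_
  · filter_upwards [eventually_gt_atTop 0] with r hr
    have := h.α_pos hr
    positivity
  · filter_upwards [eventually_gt_atTop 0] with r hr using h.sq_mul_α_le hr

lemma tendsto_α_atTop (h : IsProfile n p q u α v β) : Tendsto α atTop (𝓝 0) := by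
  refine tendsto_of_tendsto_of_tendsto_of_le_of_le' tendsto_const_nhds h.tendsto_sq_mul ?_ ?_
  · filter_upwards [eventually_gt_atTop 0] with r hr using (h.α_pos hr).le
  · filter_upwards [eventually_ge_atTop 1] with r hr
    exact le_mul_of_one_le_left (h.α_pos (by linarith)).le (one_le_pow₀ hr)

lemma scaling_tendsto_atTop (h : IsProfile n p q u α v β) :
    Tendsto (scaling n q u α) atTop (𝓝 0) := by
  have h1 := (h.u_lim.const_mul (n / (q + 1) : ℝ)).sub h.tendsto_sq_mul
  rwa [mul_zero, sub_zero] at h1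

lemma scaling_slope_lim (h : IsProfile n p q u α v β) :
    Tendsto (fun r => r ^ n * (n / (p + 1) * α r - v r ^ p)) (𝓝[>] 0) (𝓝 0) := by
  have h0 := tendsto_pow_nhdsGT_zero (n := n) (by have := h.hn; omega)
  have h1 : Tendsto v (𝓝[>] 0) (𝓝 (v 0)) := h.v_cont.continuousAt.tendsto.mono_left inf_le_left
  simpa using h0.mul ((h.α_lim.const_mul (n / (p + 1) : ℝ)).sub
    (h1.rpow_const (p := p) (Or.inr h.hp.le)))

lemma radialSol_scaling (h : IsProfile n p q u α v β) :
    RadialSol n (potentialBound p q u v) (fun r => p * v r ^ (p - 1))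
      (fun r => q * u r ^ (q - 1)) (scaling n q u α) (fun r => n / (p + 1) * α r - v r ^ p)
      (scaling n p v β) (fun r => n / (q + 1) * β r - u r ^ q) where
  d_pos := by have := h.hn; omega
  c₁_nonneg r _ := h.potential_nonneg r
  c₂_nonneg r _ := h.swap.potential_nonneg r
  c₁_le := h.potential_le_bound
  c₂_le := h.potential_le_bound'
  μ_deriv := h.scaling_deriv
  ν_deriv := h.swap.scaling_deriv
  μ₁_deriv := h.scaling_slope_deriv
  ν₁_deriv := h.swap.scaling_slope_deriv
  μ₁_lim := h.scaling_slope_lim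
  ν₁_lim := h.swap.scaling_slope_lim

lemma translation_slope_deriv (h : IsProfile n p q u α v β) (r : ℝ) (hr : 0 < r) :
    HasDerivAt (slope₁ n p α v)
      ((-(p * v r ^ (p - 1) * β r) - (n + 2 : ℕ) * slope₁ n p α v r) / r) r := by
  refine (h.slope₁_deriv r hr).congr_deriv ?_
  rw [slope₂]
  field_simp
  push_cast
  ring

lemma translation_slope_lim (h : IsProfile n p q u α v β) :
    Tendsto (fun r => r ^ (n + 2) * slope₁ n p α v r) (𝓝[>] 0) (𝓝 0) := by
  have h0 := tendsto_pow_nhdsGT_zero (n := n) (by have := h.hn; omega)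
  have h1 : Tendsto v (𝓝[>] 0) (𝓝 (v 0)) := h.v_cont.continuousAt.tendsto.mono_left inf_le_left
  have h2 := h0.mul ((h1.rpow_const (p := p) (Or.inr h.hp.le)).sub
    (h.α_lim.const_mul (n : ℝ)))
  rw [zero_mul] at h2
  refine h2.congr' ?_
  filter_upwards [self_mem_nhdsWithin] with r (hr : 0 < r)
  rw [slope₁]
  field_simp
  ring

lemma radialSol_translation (h : IsProfile n p q u α v β) :
    RadialSol (n + 2) (potentialBound p q u v) (fun r => p * v r ^ (p - 1))
      (fun r => q * u r ^ (q - 1)) α (slope₁ n p α v) β (slope₁ n q β u) where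
  d_pos := by omega
  c₁_nonneg r _ := h.potential_nonneg r
  c₂_nonneg r _ := h.swap.potential_nonneg r
  c₁_le := h.potential_le_bound
  c₂_le := h.potential_le_bound'
  μ_deriv := h.α_deriv
  ν_deriv := h.β_deriv
  μ₁_deriv := h.translation_slope_deriv
  ν₁_deriv := h.swap.translation_slope_deriv
  μ₁_lim := h.translation_slope_lim
  ν₁_lim := h.swap.translation_slope_lim

end IsProfile

namespace LinSol

variable {n : ℕ} {p q : ℝ} {u α v β : ℝ → ℝ} {φ ψ : Euc n → ℝ}

lemma tendsto_ray_atTop {F : Euc n → ℝ} (hF : Tendsto F (cocompact _) (𝓝 0)) (i : Fin n) :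
    Tendsto (fun r : ℝ => F (r • stdVec i)) atTop (𝓝 0) := by
  refine hF.comp ?_
  rw [← Metric.cobounded_eq_cocompact, ← tendsto_norm_atTop_iff_cobounded]
  exact tendsto_abs_atTop_atTop.congr fun r => (norm_smul_stdVec i r).symm

lemma tendsto_ray_zero {F : Euc n → ℝ} (hF : ContDiff ℝ 2 F) (i : Fin n) :
    Tendsto (fun r : ℝ => F (r • stdVec i)) (𝓝[>] 0) (𝓝 (F 0)) := by
  have := (contDiff_ray hF (stdVec i)).continuous.tendsto 0
  simp only [zero_smul] at this
  exact this.mono_left inf_le_left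

lemma radial_slope_facts (hn : n ≠ 0) {F G : Euc n → ℝ} {c : ℝ → ℝ} (hF : ContDiff ℝ 2 F)
    (hFr : ∀ x y : Euc n, ‖x‖ = ‖y‖ → F x = F y) (hGr : ∀ x y : Euc n, ‖x‖ = ‖y‖ → G x = G y)
    (hFG : ∀ x, -lap F x = c ‖x‖ * G x) (i : Fin n) :
    (∀ r, 0 < r → HasDerivAt (fun r => -raySlope F (stdVec i) r)
      ((-(c r * G (r • stdVec i)) - n * -raySlope F (stdVec i) r) / r) r) ∧
    Tendsto (fun r => r ^ n * -raySlope F (stdVec i) r) (𝓝[>] 0) (𝓝 0) := by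
  have hf : ∀ x, -lap F x = (fun r => c r * G (r • stdVec i)) ‖x‖ := fun x => by
    rw [hFG, hGr x (‖x‖ • stdVec i) (by rw [norm_smul_stdVec, abs_norm])]
  refine ⟨fun r hr => ((hasDerivAt_raySlope hFr (f := fun r => c r * G (r • stdVec i))
    hf hF i hr).fun_neg).congr_deriv ?_, ?_⟩
  · field_simp
    ring
  · simpa using (tendsto_pow_nhdsGT_zero hn).mul
      (tendsto_raySlope hFr (f := fun r => c r * G (r • stdVec i)) hf hF i).neg

/-- Radial solutions of the linearized system come from the scaling family. -/
lemma radial_eq (h : IsProfile n p q u α v β) (s : LinSol n p q u v φ ψ)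
    (hφ : ∀ x y : Euc n, ‖x‖ = ‖y‖ → φ x = φ y) (hψ : ∀ x y : Euc n, ‖x‖ = ‖y‖ → ψ x = ψ y)
    {c : ℝ} (hc : φ 0 = c * (n / (q + 1) * u 0)) {x : Euc n} (hx : x ≠ 0) :
    φ x = c * IsProfile.scaling n q u α ‖x‖ ∧ ψ x = c * IsProfile.scaling n p v β ‖x‖ := by
  have hn : n ≠ 0 := by have := h.hn; omega
  set i : Fin n := ⟨0, by omega⟩
  have f1 := radial_slope_facts (c := fun r => p * v r ^ (p - 1)) hn
    s.contDiff_left hφ hψ s.eq_left i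
  have f2 := radial_slope_facts (c := fun r => q * u r ^ (q - 1)) hn
    s.contDiff_right hψ hφ s.eq_right i
  have hR : RadialSol n (IsProfile.potentialBound p q u v) (fun r => p * v r ^ (p - 1))
      (fun r => q * u r ^ (q - 1)) (fun r => φ (r • stdVec i))
      (fun r => -raySlope φ (stdVec i) r) (fun r => ψ (r • stdVec i))
      (fun r => -raySlope ψ (stdVec i) r) :=
    { h.radialSol_scaling with
      μ_deriv := fun r hr => hasDerivAt_ray s.contDiff_left _ hr
      ν_deriv := fun r hr => hasDerivAt_ray s.contDiff_right _ hr
      μ₁_deriv := f1.1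
      ν₁_deriv := f2.1
      μ₁_lim := f1.2
      ν₁_lim := f2.2 }
  have hμ := (tendsto_ray_zero s.contDiff_left i).sub (h.scaling_tendsto_zero.const_mul c)
  rw [← hc, sub_self] at hμ
  have hinf := (tendsto_ray_atTop s.decay_right i).sub (h.swap.scaling_tendsto_atTop.const_mul c)
  rw [mul_zero, sub_zero] at hinf
  have key := (hR.sub_const_mul h.radialSol_scaling c).eq_zero hμ
    ((tendsto_ray_zero s.contDiff_right i).sub (h.swap.scaling_tendsto_zero.const_mul c)) hinf
    (norm_pos_iff.2 hx)
  have hnorm : ‖x‖ = ‖‖x‖ • (stdVec i : Euc n)‖ := by rw [norm_smul_stdVec, abs_norm]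
  rw [hφ x _ hnorm, hψ x _ hnorm]
  exact ⟨sub_eq_zero.1 key.1, sub_eq_zero.1 key.2⟩

end LinSol

section OddRay

variable {n : ℕ} {χ : Euc n → ℝ}

/-- For `m r = χ (r • e) / r`, this is `m' / r`. -/
noncomputable def oddSlope (χ : Euc n → ℝ) (e : Euc n) (r : ℝ) : ℝ :=
  (deriv (fun t : ℝ => χ (t • e)) r - χ (r • e) / r) / r ^ 2

lemma hasDerivAt_ray_div (hχ : ContDiff ℝ 2 χ) (e : Euc n) {r : ℝ} (hr : 0 < r) :
    HasDerivAt (fun t : ℝ => χ (t • e) / t) (r * oddSlope χ e r) r := by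
  refine ((((contDiff_ray hχ e).differentiable (by norm_num)) r).hasDerivAt.fun_div
    (hasDerivAt_id r) hr.ne').congr_deriv ?_
  simp only [oddSlope, id]
  field_simp

lemma hasDerivAt_oddSlope (hχ : ContDiff ℝ 2 χ) (e : Euc n) {r : ℝ} (hr : 0 < r) :
    HasDerivAt (oddSlope χ e)
      (r * ((deriv (deriv fun t : ℝ => χ (t • e)) r - 3 * r * oddSlope χ e r) / r ^ 3)) r := by
  refine (((hasDerivAt_deriv_ray hχ e r).fun_sub (hasDerivAt_ray_div hχ e hr)).fun_div
    (hasDerivAt_pow 2 r) (by positivity)).congr_deriv ?_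
  simp only [oddSlope]
  field_simp
  push_cast
  ring

lemma tendsto_ray_div (hχ : ContDiff ℝ 2 χ) (h0 : χ 0 = 0) (e : Euc n) :
    Tendsto (fun t : ℝ => χ (t • e) / t) (𝓝[>] 0) (𝓝 (fderiv ℝ χ 0 e)) := by
  have hl : HasDerivAt (fun t : ℝ => t • e) e 0 := by
    simpa using (hasDerivAt_id (0 : ℝ)).smul_const e
  have hd : HasDerivAt (fun t : ℝ => χ (t • e)) (fderiv ℝ χ 0 e) 0 := by
    have h1 : HasFDerivAt χ (fderiv ℝ χ 0) ((0 : ℝ) • e) := by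
      rw [zero_smul]
      exact ((hχ.differentiable (by norm_num)) 0).hasFDerivAt
    exact h1.comp_hasDerivAt 0 hl
  have ht := (hasDerivAt_iff_tendsto_slope.1 hd).mono_left
    (nhdsWithin_mono 0 (fun x (hx : 0 < x) => hx.ne') : 𝓝[>] (0 : ℝ) ≤ 𝓝[≠] 0)
  refine ht.congr fun r => ?_
  rw [slope_def_field, zero_smul, h0]
  ring

lemma tendsto_oddSlope (hn : n ≠ 0) (hχ : ContDiff ℝ 2 χ) (h0 : χ 0 = 0) (e : Euc n) :
    Tendsto (fun r => r ^ (n + 2) * oddSlope χ e r) (𝓝[>] 0) (𝓝 0) := by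
  have h1 : Tendsto (deriv fun t : ℝ => χ (t • e)) (𝓝[>] 0)
      (𝓝 (deriv (fun t : ℝ => χ (t • e)) 0)) :=
    (hasDerivAt_deriv_ray hχ e 0).continuousAt.tendsto.mono_left inf_le_left
  have h2 := (tendsto_pow_nhdsGT_zero hn).mul (h1.sub (tendsto_ray_div hχ h0 e))
  rw [zero_mul] at h2
  refine h2.congr' ?_
  filter_upwards [self_mem_nhdsWithin] with r (hr : 0 < r)
  rw [oddSlope]
  field_simp
  ring

lemma lap_odd_ray (hn : 3 ≤ n) (hχ : ContDiff ℝ 2 χ) (hodd : ∀ x, χ (-x) = -χ x)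
    (hC : ∀ z a b : Euc n, inner ℝ z a = 0 → inner ℝ z b = 0 → ‖a‖ = ‖b‖ →
      χ (z + a) + χ (z - a) = χ (z + b) + χ (z - b)) (i : Fin n) {r : ℝ} (hr : 0 < r) :
    lap χ (r • stdVec i) = deriv (deriv fun t : ℝ => χ (t • stdVec i)) r +
      (n - 1) * (r * oddSlope χ (stdVec i) r) := by
  have hx : r • (stdVec i : Euc n) ≠ 0 := by
    rw [← norm_ne_zero_iff, norm_smul_stdVec]
    positivity
  have hnorm : ‖r • (stdVec i : Euc n)‖ = r := by rw [norm_smul_stdVec, abs_of_pos hr]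
  have hi : HasSecondDerivAt (fun t : ℝ => χ (r • stdVec i + t • stdVec i))
      (deriv (deriv fun t : ℝ => χ (t • stdVec i)) r) 0 := by
    refine ⟨fun t => deriv (fun t : ℝ => χ (t • stdVec i)) (r + t), .of_forall fun t => ?_, ?_⟩
    · simp only [← add_smul]
      exact (((contDiff_ray hχ (stdVec i)).differentiable
        (by norm_num)) (r + t)).hasDerivAt.comp_const_add r t
    · have h1 := hasDerivAt_deriv_ray hχ (stdVec i) (r + 0)
      simpa only [add_zero] using h1.comp_const_add r 0
  have hj : ∀ j, j ≠ i → fderiv ℝ (fderiv ℝ χ) (r • stdVec i) (stdVec j) (stdVec j) =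
      r * oddSlope χ (stdVec i) r := fun j hji => by
    obtain ⟨l, hl⟩ : ∃ l, l ∉ ({i, j} : Finset (Fin n)) := by
      by_contra! hall
      have h1 : (Finset.univ : Finset (Fin n)) ⊆ {i, j} := fun l _ => hall l
      have h2 := (Finset.card_le_card h1).trans Finset.card_le_two
      simp at h2
      omega
    have hil : i ≠ l := fun hh => hl (by simp [hh])
    have hjl : j ≠ l := fun hh => hl (by simp [hh])
    have h1 := hasSecondDerivAt_line hχ (r • stdVec i) (stdVec j)
    have h2 := (h1.add h1.comp_neg).const_mul (1 / 2)
    have h3 := (hasSecondDerivAt_radial_line (fun r hr => hasDerivAt_ray_div hχ (stdVec i) hr)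
      (fun r hr => hasDerivAt_oddSlope hχ (stdVec i) hr) hx j).const_mul r
    have hxj : (r • (stdVec i : Euc n)) j = 0 := by simp [hji]
    rw [hxj, hnorm] at h3
    have h4 := h2.unique (h3.congr (.of_forall fun t => ?_))
    · linarith
    · have hsq := norm_add_smul_stdVec_sq (r • (stdVec i : Euc n)) j t
      rw [hxj, hnorm, mul_zero, add_zero] at hsq
      have hpos : 0 < ‖r • (stdVec i : Euc n) + t • stdVec j‖ := by
        refine (sq_pos_iff.1 ?_).lt_of_le' (norm_nonneg _)
        rw [hsq]
        positivity
      have := sum_pair_eq hχ.continuous hodd hC hji.symm hil hjl hpos hsq.symm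
      beta_reduce
      rw [neg_smul, ← sub_eq_add_neg, this]
      ring
  rw [lap, ← Finset.add_sum_erase _ _ (Finset.mem_univ i),
    Finset.sum_congr rfl fun j hjm => hj j (Finset.ne_of_mem_erase hjm),
    (hasSecondDerivAt_line hχ (r • stdVec i) (stdVec i)).unique hi]
  simp [Finset.card_erase_of_mem, Nat.cast_sub (show 1 ≤ n by omega)]

end OddRay

namespace LinSol

variable {n : ℕ} {p q : ℝ} {u α v β : ℝ → ℝ} {φ ψ : Euc n → ℝ}

lemma hasDerivAt_oddSlope_of_eq (hn : 3 ≤ n) {χ ω : Euc n → ℝ} {c : ℝ → ℝ} (hχ : ContDiff ℝ 2 χ)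
    (hodd : ∀ x, χ (-x) = -χ x)
    (hC : ∀ z a b : Euc n, inner ℝ z a = 0 → inner ℝ z b = 0 → ‖a‖ = ‖b‖ →
      χ (z + a) + χ (z - a) = χ (z + b) + χ (z - b))
    (hχω : ∀ x, -lap χ x = c ‖x‖ * ω x) (i : Fin n) (r : ℝ) (hr : 0 < r) :
    HasDerivAt (oddSlope χ (stdVec i))
      ((-(c r * (ω (r • stdVec i) / r)) - (n + 2 : ℕ) * oddSlope χ (stdVec i) r) / r) r := by
  refine (hasDerivAt_oddSlope hχ (stdVec i) hr).congr_deriv ?_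
  have h1 := lap_odd_ray hn hχ hodd hC i hr
  have h2 := hχω (r • stdVec i)
  rw [h1, norm_smul_stdVec, abs_of_pos hr] at h2
  have h3 : deriv (deriv fun t : ℝ => χ (t • stdVec i)) r = -(c r * ω (r • stdVec i)) -
      (n - 1) * (r * oddSlope χ (stdVec i) r) := by linarith
  rw [h3]
  field_simp
  push_cast
  ring

/-- Odd solutions of the linearized system along a coordinate ray. -/
lemma odd_ray_eq (h : IsProfile n p q u α v β) (s : LinSol n p q u v φ ψ)
    (hφ : ∀ x, φ (-x) = -φ x) (hψ : ∀ x, ψ (-x) = -ψ x) (i : Fin n)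
    {c : ℝ} (hc : fderiv ℝ φ 0 (stdVec i) = c * (v 0 ^ p / n)) {r : ℝ} (hr : 0 < r) :
    φ (r • stdVec i) = r * c * α r ∧ ψ (r • stdVec i) = r * c * β r := by
  have hn : n ≠ 0 := by have := h.hn; omega
  have φ0 : φ 0 = 0 := by have := hφ 0; rw [neg_zero] at this; linarith
  have ψ0 : ψ 0 = 0 := by have := hψ 0; rw [neg_zero] at this; linarith
  have hR : RadialSol (n + 2) (IsProfile.potentialBound p q u v) (fun r => p * v r ^ (p - 1))
      (fun r => q * u r ^ (q - 1)) (fun r => φ (r • stdVec i) / r) (oddSlope φ (stdVec i))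
      (fun r => ψ (r • stdVec i) / r) (oddSlope ψ (stdVec i)) :=
    { h.radialSol_translation with
      μ_deriv := fun r hr => hasDerivAt_ray_div s.contDiff_left _ hr
      ν_deriv := fun r hr => hasDerivAt_ray_div s.contDiff_right _ hr
      μ₁_deriv := hasDerivAt_oddSlope_of_eq h.hn s.contDiff_left hφ
        (fun z a b => s.antipodal_sum_eq h) (c := fun r => p * v r ^ (p - 1)) s.eq_left i
      ν₁_deriv := hasDerivAt_oddSlope_of_eq h.hn s.contDiff_right hψ
        (fun z a b => s.swap.antipodal_sum_eq h.swap) (c := fun r => q * u r ^ (q - 1))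
        s.eq_right i
      μ₁_lim := tendsto_oddSlope hn s.contDiff_left φ0 _
      ν₁_lim := tendsto_oddSlope hn s.contDiff_right ψ0 _ }
  have hμ := (tendsto_ray_div s.contDiff_left φ0 (stdVec i)).sub (h.α_lim.const_mul c)
  rw [← hc, sub_self] at hμ
  have hinf := ((tendsto_ray_atTop s.decay_right i).div_atTop tendsto_id).sub
    (h.swap.tendsto_α_atTop.const_mul c)
  rw [mul_zero, sub_zero] at hinf
  have key := (hR.sub_const_mul h.radialSol_translation c).eq_zero hμ
    ((tendsto_ray_div s.contDiff_right ψ0 (stdVec i)).sub (h.β_lim.const_mul c)) hinf hr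
  obtain ⟨k1, k2⟩ := key
  beta_reduce at k1 k2
  rw [sub_eq_zero, div_eq_iff hr.ne'] at k1 k2
  exact ⟨by rw [k1]; ring, by rw [k2]; ring⟩

/-- Odd solutions of the linearized system come from translations. -/
lemma odd_eq (h : IsProfile n p q u α v β) (s : LinSol n p q u v φ ψ)
    (hφ : ∀ x, φ (-x) = -φ x) (hψ : ∀ x, ψ (-x) = -ψ x) {x : Euc n} (hx : x ≠ 0) :
    φ x = fderiv ℝ φ 0 x / (v 0 ^ p / n) * α ‖x‖ ∧
      ψ x = fderiv ℝ φ 0 x / (v 0 ^ p / n) * β ‖x‖ := by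
  have hn := h.three_le
  have hα : v 0 ^ p / n ≠ 0 :=
    (div_pos (Real.rpow_pos_of_pos (h.v_pos 0) p) (by linarith)).ne'
  have hr : 0 < ‖x‖ := norm_pos_iff.2 hx
  set i : Fin n := ⟨0, by have := h.hn; omega⟩
  set e : Euc n := ‖x‖⁻¹ • x with he
  set T : Euc n ≃ₗᵢ[ℝ] Euc n := Submodule.reflection (ℝ ∙ (stdVec i - e))ᗮ
  have hT : T (stdVec i) = e := Submodule.reflection_sub (by
    rw [he, norm_smul, norm_inv, norm_norm, inv_mul_cancel₀ hr.ne']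
    simp)
  have hre : ‖x‖ • e = x := by rw [he, smul_smul, mul_inv_cancel₀ hr.ne', one_smul]
  have hTx : T (‖x‖ • stdVec i) = x := by rw [map_smul, hT, hre]
  have hd : fderiv ℝ (fun y => φ (T y)) 0 (stdVec i) = fderiv ℝ φ 0 e := by
    have h1 : HasFDerivAt φ (fderiv ℝ φ 0) (T 0) := by
      rw [map_zero]
      exact ((s.contDiff_left.differentiable (by norm_num)) 0).hasFDerivAt
    have h2 := h1.comp 0 T.toContinuousLinearEquiv.hasFDerivAt
    rw [show (fun y => φ (T y)) = φ ∘ T from rfl, h2.fderiv, ← hT]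
    rfl
  have key := odd_ray_eq h (s.comp_isometry T) (fun y => by rw [map_neg, hφ])
    (fun y => by rw [map_neg, hψ]) i (c := fderiv ℝ φ 0 e / (v 0 ^ p / n))
    (by rw [hd, div_mul_cancel₀ _ hα]) hr
  rw [hTx] at key
  have hx' : fderiv ℝ φ 0 x = ‖x‖ * fderiv ℝ φ 0 e := by
    rw [← smul_eq_mul, ← map_smul, hre]
  rw [hx', mul_div_assoc]
  exact key

end LinSol

/-- The linearized system has only the solutions generated by scaling and translations. -/
lemma LinSol.exists_eq {n : ℕ} {p q : ℝ} {u α v β : ℝ → ℝ} {φ ψ : Euc n → ℝ}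
    (h : IsProfile n p q u α v β) (s : LinSol n p q u v φ ψ) :
    ∃ (c₀ : ℝ) (L : Euc n →L[ℝ] ℝ), ∀ x, x ≠ 0 →
      φ x = L x * α ‖x‖ + c₀ * IsProfile.scaling n q u α ‖x‖ ∧
      ψ x = L x * β ‖x‖ + c₀ * IsProfile.scaling n p v β ‖x‖ := by
  have sn := s.comp_isometry (LinearIsometryEquiv.neg ℝ)
  simp only [LinearIsometryEquiv.coe_neg] at sn
  have se := (s.add sn).const_mul (1 / 2)
  have so := (s.sub sn).const_mul (1 / 2)
  have hσ : (n : ℝ) / (q + 1) * u 0 ≠ 0 := (mul_pos h.swap.exponent_pos (h.u_pos 0)).ne'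
  refine ⟨1 / 2 * (φ 0 + φ (-0)) / (n / (q + 1) * u 0),
    (v 0 ^ p / n)⁻¹ • fderiv ℝ (fun x => 1 / 2 * (φ x - φ (-x))) 0, fun x hx => ?_⟩
  have he := se.radial_eq h
    (fun x y hxy => by
      have := s.antipodal_sum_eq h (inner_zero_left x) (inner_zero_left y) hxy
      simp only [zero_add, zero_sub] at this
      rw [this])
    (fun x y hxy => by
      have := s.swap.antipodal_sum_eq h.swap (inner_zero_left x) (inner_zero_left y) hxy
      simp only [zero_add, zero_sub] at this
      rw [this]) (div_mul_cancel₀ _ hσ).symm hx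
  have ho := so.odd_eq h (fun x => by rw [neg_neg]; ring) (fun x => by rw [neg_neg]; ring) hx
  rw [div_eq_inv_mul (fderiv ℝ _ 0 x)] at ho
  rw [smul_apply, smul_eq_mul]
  exact ⟨by linarith [he.1, ho.1], by linarith [he.2, ho.2]⟩

lemma near_of_abs_sub_le {n p q : ℝ} (hn : 3 ≤ n) (hp : 0 < p)
    (hyp : 1 / (p + 1) + 1 / (q + 1) = (n - 2) / n)
    (h : |p - (n + 2) / (n - 2)| ≤ 1 / (20 * (n - 2))) :
    |n / (q + 1) - n / (p + 1)| ≤ 1 / 20 := by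
  have hn2 : 0 < n - 2 := by linarith
  have h1 : n / (q + 1) = n - 2 - n / (p + 1) := by
    have : n / (q + 1) = n * (1 / (p + 1) + 1 / (q + 1)) - n / (p + 1) := by ring
    rw [this, hyp]
    field_simp
  have h2 : n / (q + 1) - n / (p + 1) = (n - 2) / (p + 1) * (p - (n + 2) / (n - 2)) := by
    rw [h1]
    field_simp
    ring
  rw [h2, abs_mul, abs_of_pos (by positivity)]
  calc (n - 2) / (p + 1) * |p - (n + 2) / (n - 2)| ≤ (n - 2) * (1 / (20 * (n - 2))) :=
        mul_le_mul (div_le_self hn2.le (by linarith)) h (abs_nonneg _) hn2.le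
    _ = 1 / 20 := by field_simp

namespace IsGroundState

variable {n : ℕ} {p q : ℝ} {U V : Euc n → ℝ}

lemma eq_of_norm_eq {F : Euc n → ℝ} (hF : ∀ x y : Euc n, ‖x‖ ≤ ‖y‖ → F y ≤ F x) (x y : Euc n)
    (hxy : ‖x‖ = ‖y‖) : F x = F y :=
  le_antisymm (hF y x hxy.ge) (hF x y hxy.le)

lemma eq_ray_norm {F : Euc n → ℝ} (hF : ∀ x y : Euc n, ‖x‖ ≤ ‖y‖ → F y ≤ F x) (i : Fin n)
    (x : Euc n) : F x = F (‖x‖ • stdVec i) :=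
  eq_of_norm_eq hF _ _ (by rw [norm_smul_stdVec, abs_norm])

lemma isProfile (h : IsGroundState n p q U V) (hn : 3 ≤ n) (hp : 0 < p) (hq : 0 < q)
    (hyp : 1 / (p + 1) + 1 / (q + 1) = ((n : ℝ) - 2) / n)
    (hnear : |(n : ℝ) / (q + 1) - n / (p + 1)| ≤ 1 / 20) (i : Fin n) :
    IsProfile n p q (fun r => U (r • stdVec i)) (raySlope U (stdVec i))
      (fun r => V (r • stdVec i)) (raySlope V (stdVec i)) := by
  obtain ⟨hU, hV, U_pos, V_pos, U_eq, V_eq, U_anti, V_anti, U_lim, V_lim, -⟩ := h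
  have hUe : ∀ x, -lap U x = (fun r : ℝ => V (r • stdVec i) ^ p) ‖x‖ := fun x => by
    rw [U_eq, eq_ray_norm V_anti i x]
  have hVe : ∀ x, -lap V x = (fun r : ℝ => U (r • stdVec i) ^ q) ‖x‖ := fun x => by
    rw [V_eq, eq_ray_norm U_anti i x]
  have hle : ∀ r s : ℝ, 0 ≤ r → r ≤ s → ‖r • (stdVec i : Euc n)‖ ≤ ‖s • (stdVec i : Euc n)‖ :=
    fun r s hr hrs => by
      rw [norm_smul_stdVec, norm_smul_stdVec, abs_of_nonneg hr, abs_of_nonneg (hr.trans hrs)]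
      exact hrs
  exact
    { hn := hn
      hp := hp
      hq := hq
      hyp := hyp
      near := hnear
      u_pos := fun r => U_pos _
      v_pos := fun r => V_pos _
      u_cont := (contDiff_ray hU _).continuous
      v_cont := (contDiff_ray hV _).continuous
      u_anti := fun r s hr hrs => U_anti _ _ (hle r s hr hrs)
      v_anti := fun r s hr hrs => V_anti _ _ (hle r s hr hrs)
      u_lim := LinSol.tendsto_ray_atTop U_lim i
      v_lim := LinSol.tendsto_ray_atTop V_lim i
      u_deriv := fun r hr => hasDerivAt_ray hU _ hr
      v_deriv := fun r hr => hasDerivAt_ray hV _ hr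
      α_deriv := fun r hr => hasDerivAt_raySlope (eq_of_norm_eq U_anti)
        (f := fun r : ℝ => V (r • stdVec i) ^ p) hUe hU i hr
      β_deriv := fun r hr => hasDerivAt_raySlope (eq_of_norm_eq V_anti)
        (f := fun r : ℝ => U (r • stdVec i) ^ q) hVe hV i hr
      α_lim := tendsto_raySlope (eq_of_norm_eq U_anti)
        (f := fun r : ℝ => V (r • stdVec i) ^ p) hUe hU i
      β_lim := tendsto_raySlope (eq_of_norm_eq V_anti)
        (f := fun r : ℝ => U (r • stdVec i) ^ q) hVe hV i }

lemma fderiv_stdVec {F : Euc n → ℝ} (hF : ContDiff ℝ 2 F)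
    (hanti : ∀ x y : Euc n, ‖x‖ ≤ ‖y‖ → F y ≤ F x) (i j : Fin n) {x : Euc n} (hx : x ≠ 0) :
    fderiv ℝ F x (stdVec j) = -(x j * raySlope F (stdVec i) ‖x‖) := by
  have h1 := hasDerivAt_radial_line (G := fun r : ℝ => F (r • stdVec i))
    (fun r hr => hasDerivAt_ray hF (stdVec i) hr) (x := x) (i := j) (t := 0) (by simpa using hx)
  simp only [← eq_ray_norm hanti i, zero_smul, add_zero] at h1
  have hl : HasDerivAt (fun t : ℝ => x + t • (stdVec j : Euc n)) (stdVec j) 0 := by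
    simpa using ((hasDerivAt_id (0 : ℝ)).smul_const (stdVec j : Euc n)).const_add x
  have h2 : HasFDerivAt F (fderiv ℝ F x) (x + (0 : ℝ) • stdVec j) := by
    rw [zero_smul, add_zero]
    exact ((hF.differentiable (by norm_num)) x).hasFDerivAt
  rw [(h2.comp_hasDerivAt 0 hl).unique h1]
  ring

lemma map_eq_sum (L : Euc n →L[ℝ] ℝ) (x : Euc n) : L x = ∑ j, x j * L (stdVec j) := by
  conv_lhs => rw [← (EuclideanSpace.basisFun (Fin n) ℝ).sum_repr x]
  simp

lemma fderiv_self {F : Euc n → ℝ} (hF : ContDiff ℝ 2 F)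
    (hanti : ∀ x y : Euc n, ‖x‖ ≤ ‖y‖ → F y ≤ F x) (i : Fin n) {x : Euc n} (hx : x ≠ 0) :
    fderiv ℝ F x x = -(‖x‖ ^ 2 * raySlope F (stdVec i) ‖x‖) := by
  rw [map_eq_sum, EuclideanSpace.real_norm_sq_eq, Finset.sum_mul, ← Finset.sum_neg_distrib]
  refine Finset.sum_congr rfl fun j _ => ?_
  rw [fderiv_stdVec hF hanti i j hx]
  ring

/-- Rewriting of a combination of the radial profiles through derivatives of `F`. -/
lemma eq_of_eq_profile {F χ : Euc n → ℝ} (hF : ContDiff ℝ 2 F) (hχ : Continuous χ)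
    (hanti : ∀ x y : Euc n, ‖x‖ ≤ ‖y‖ → F y ≤ F x) (i : Fin n) {L : Euc n →L[ℝ] ℝ} {c₀ σ : ℝ}
    (h : ∀ x, x ≠ 0 → χ x = L x * raySlope F (stdVec i) ‖x‖ +
      c₀ * (σ * F (‖x‖ • stdVec i) - ‖x‖ ^ 2 * raySlope F (stdVec i) ‖x‖)) (x : Euc n) :
    χ x = (∑ j, -L (stdVec j) * fderiv ℝ F x (stdVec j)) + c₀ * (fderiv ℝ F x x + σ * F x) := by
  have : Nonempty (Fin n) := ⟨i⟩
  have hF' : Continuous (fderiv ℝ F) := hF.continuous_fderiv (by norm_num)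
  have hFc := hF.continuous
  have hc : Continuous fun x => (∑ j, -L (stdVec j) * fderiv ℝ F x (stdVec j)) +
      c₀ * (fderiv ℝ F x x + σ * F x) := by fun_prop
  refine congrFun (Continuous.ext_on (dense_compl_singleton (0 : Euc n)) hχ hc
    fun x (hx : x ≠ 0) => ?_) x
  beta_reduce
  rw [h x hx, fderiv_self hF hanti i hx, ← eq_ray_norm hanti i, map_eq_sum L, Finset.sum_mul]
  congr 1
  · refine Finset.sum_congr rfl fun j _ => ?_
    rw [fderiv_stdVec hF hanti i j hx]
    ring
  · ring

end IsGroundState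

theorem nondegeneracy_near_critical (n : ℕ) (hn : 3 ≤ n) :
    ∃ ε₃ : ℝ, 0 < ε₃ ∧
      ∀ p q : ℝ, 0 < p → 0 < q →
        1 / (p + 1) + 1 / (q + 1) = ((n : ℝ) - 2) / n →
        |p - ((n : ℝ) + 2) / ((n : ℝ) - 2)| ≤ ε₃ →
        ∀ U V : EuclideanSpace ℝ (Fin n) → ℝ, IsGroundState n p q U V →
        ∀ φ ψ : EuclideanSpace ℝ (Fin n) → ℝ,
          ContDiff ℝ 2 φ → ContDiff ℝ 2 ψ →
          (∀ x, -lap φ x = p * V x ^ (p - 1) * ψ x) →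
          (∀ x, -lap ψ x = q * U x ^ (q - 1) * φ x) →
          Tendsto φ (cocompact _) (nhds 0) →
          Tendsto ψ (cocompact _) (nhds 0) →
          ∃ (c : Fin n → ℝ) (c₀ : ℝ),
            (∀ x, φ x = (∑ j, c j * fderiv ℝ U x (EuclideanSpace.single j 1)) +
              c₀ * (fderiv ℝ U x x + ((n : ℝ) - 2 - (n : ℝ) / (p + 1)) * U x)) ∧
            (∀ x, ψ x = (∑ j, c j * fderiv ℝ V x (EuclideanSpace.single j 1)) +
              c₀ * (fderiv ℝ V x x + ((n : ℝ) - 2 - (n : ℝ) / (q + 1)) * V x)) := by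
  have hn3 : (3 : ℝ) ≤ n := by exact_mod_cast hn
  have hn2 : (0 : ℝ) < n - 2 := by linarith
  refine ⟨1 / (20 * (n - 2)), by positivity, ?_⟩
  intro p q hp hq hyp hnear U V hUV φ ψ hφ hψ φ_eq ψ_eq φ_lim ψ_lim
  set i : Fin n := ⟨0, by omega⟩
  have h := hUV.isProfile hn hp hq hyp (near_of_abs_sub_le hn3 hp hyp hnear) i
  obtain ⟨hU, hV, -, -, -, -, U_anti, V_anti, -⟩ := hUV
  have s : LinSol n p q (fun r => U (r • stdVec i)) (fun r => V (r • stdVec i)) φ ψ :=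
    { contDiff_left := hφ
      contDiff_right := hψ
      eq_left := fun x => by rw [φ_eq, IsGroundState.eq_ray_norm V_anti i x]
      eq_right := fun x => by rw [ψ_eq, IsGroundState.eq_ray_norm U_anti i x]
      decay_left := φ_lim
      decay_right := ψ_lim }
  obtain ⟨c₀, L, hL⟩ := s.exists_eq h
  have hσ : (n : ℝ) - 2 - n / (p + 1) = n / (q + 1) := by linarith [h.exponent_sum]
  have hτ : (n : ℝ) - 2 - n / (q + 1) = n / (p + 1) := by linarith [h.exponent_sum]
  rw [hσ, hτ]
  exact ⟨fun j => -L (stdVec j), c₀,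
    IsGroundState.eq_of_eq_profile hU hφ.continuous U_anti i fun x hx => (hL x hx).1,
    IsGroundState.eq_of_eq_profile hV hψ.continuous V_anti i fun x hx => (hL x hx).2⟩
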